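/- arXiv:1904.10871 — 8 statements merged into one kernel-verified Lean document; each statement's English description precedes it below -/
import Mathlib

section
/- Let n, m be positive integers, D ∈ ℝ^{m×n} with rows indexed by a set 𝒟 of size m, S ⊆ 𝒟 with |S| = s < m, and let N̄_{-S} be a linear subspace of ℝ^n containing N_{-S}, with r̄_S := dim(N̄_{-S}). Let Ψ^{-S} = {ψ_j^{-S}}_{j∈𝒟∖S} be a dictionary for N̄_{-S}. Let f⁰ ∈ ℝ^n, let ε ∈ ℝ^n be a random vector with n i.i.d. standard Gaussian N(0,1) coordinates, and Y := f⁰ + ε. Let u > 0, v > 0 and let the tuning parameter λ > 0 satisfy λ ≥ max_{j∈𝒟∖S} ‖ψ_j^{-S}‖_n · λ₀(u). Then for every f ∈ ℝ^n, with probability at least 1 − e^{−u} − e^{−v} (with respect to the law of ε), every minimizer f̂ of g ↦ ‖Y − g‖_n² + 2λ‖Dg‖₁ over ℝ^n satisfies ‖f̂ − f⁰‖_n² ≤ ‖f − f⁰‖_n² + 4λ‖Df‖₁ + (√(r̄_S/n) + √(2v/n))². -/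
open MeasureTheory ProbabilityTheory Finset

/-- A minimizer of a squared distance plus a convex penalty satisfies the optimality inequality with
an additional quadratic gain. -/
lemma sum_sq_add_le_of_isMin {ι : Type*} [Fintype ι] {R : (ι → ℝ) → ℝ}
    (hR : ConvexOn ℝ Set.univ R) (y a b : ι → ℝ)
    (ha : ∀ g : ι → ℝ, ∑ i, (y i - a i) ^ 2 + R a ≤ ∑ i, (y i - g i) ^ 2 + R g) :
    ∑ i, (y i - a i) ^ 2 + R a + ∑ i, (b i - a i) ^ 2 ≤ ∑ i, (y i - b i) ^ 2 + R b := by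
  set A := ∑ i, (b i - a i) ^ 2 with hA
  have hA0 : 0 ≤ A := Finset.sum_nonneg fun i _ => sq_nonneg _
  by_contra! hlt
  set X := ∑ i, (y i - a i) ^ 2 + R a + A - (∑ i, (y i - b i) ^ 2 + R b) with hX
  have hX0 : 0 < X := by linarith
  have key : ∀ t : ℝ, 0 < t → t ≤ 1 → X ≤ t * A := by
    intro t ht0 ht1
    have h1 := ha ((1 - t) • a + t • b)
    have h2 := hR.2 (Set.mem_univ a) (Set.mem_univ b) (sub_nonneg.2 ht1) ht0.le (by ring)
    have h3 : ∑ i, (y i - ((1 - t) • a + t • b) i) ^ 2 =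
        (1 - t) * ∑ i, (y i - a i) ^ 2 + t * ∑ i, (y i - b i) ^ 2 - t * (1 - t) * A := by
      simp only [hA, Finset.mul_sum, ← Finset.sum_add_distrib, ← Finset.sum_sub_distrib]
      refine Finset.sum_congr rfl fun i _ => ?_
      simp only [Pi.add_apply, Pi.smul_apply, smul_eq_mul]
      ring
    rw [h3] at h1
    simp only [smul_eq_mul] at h2
    have h4 : 0 ≤ t * (t * A - X) := by rw [hX]; linarith
    linarith [nonneg_of_mul_nonneg_right h4 ht0]
  have h := key (X / (X + A)) (by positivity) ((div_le_one (by positivity)).2 (by linarith))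
  rw [div_mul_eq_mul_div, le_div_iff₀ (by positivity)] at h
  nlinarith

lemma convexOn_mul_sum_abs_mulVec {ι κ : Type*} [Fintype ι] [Fintype κ] (D : Matrix κ ι ℝ)
    {c : ℝ} (hc : 0 ≤ c) :
    ConvexOn ℝ Set.univ fun g : ι → ℝ => c * ∑ j, |D.mulVec g j| := by
  refine ⟨convex_univ, fun a _ b _ s t hs ht _ => ?_⟩
  simp only [smul_eq_mul, Matrix.mulVec_add, Matrix.mulVec_smul, Pi.add_apply, Pi.smul_apply]
  have : ∑ j, |s * D.mulVec a j + t * D.mulVec b j| ≤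
      s * ∑ j, |D.mulVec a j| + t * ∑ j, |D.mulVec b j| := by
    rw [Finset.mul_sum, Finset.mul_sum, ← Finset.sum_add_distrib]
    refine Finset.sum_le_sum fun j _ => (abs_add_le _ _).trans_eq ?_
    rw [abs_mul, abs_mul, abs_of_nonneg hs, abs_of_nonneg ht]
  calc _ ≤ c * (s * ∑ j, |D.mulVec a j| + t * ∑ j, |D.mulVec b j|) := by gcongr
    _ = _ := by ring

/-- Deterministic oracle inequality for the analysis estimator on the event where the noise is
controlled both along the dictionary and on the subspace `N`. -/
lemma analysis_oracle_inequality {ι κ : Type*} [Fintype ι] [Fintype κ] [DecidableEq κ]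
    (D : Matrix κ ι ℝ) (T : Finset κ) (N : Submodule ℝ (ι → ℝ)) (ψ : κ → ι → ℝ)
    (hdict : ∀ f : ι → ℝ,
      f - (∑ j ∈ T, D.mulVec f j • ψ j) ∈ N ∧
      ∀ g ∈ N, (∑ i, (∑ j ∈ T, D.mulVec f j • ψ j) i * g i) = 0)
    {c B : ℝ} (hc : 0 ≤ c) (f0 ε fhat f : ι → ℝ)
    (hψ : ∀ j ∈ T, |∑ i, ψ j i * ε i| ≤ c)
    (hN : ∀ q ∈ N, 2 * ∑ i, ε i * q i ≤ B + ∑ i, q i ^ 2)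
    (hmin : ∀ g : ι → ℝ, ∑ i, (f0 i + ε i - fhat i) ^ 2 + 2 * c * ∑ j, |D.mulVec fhat j| ≤
      ∑ i, (f0 i + ε i - g i) ^ 2 + 2 * c * ∑ j, |D.mulVec g j|) :
    ∑ i, (fhat i - f0 i) ^ 2 ≤ ∑ i, (f i - f0 i) ^ 2 + 4 * c * ∑ j, |D.mulVec f j| + B := by
  have hopt := sum_sq_add_le_of_isMin
    (convexOn_mul_sum_abs_mulVec D (show 0 ≤ 2 * c by linarith)) (fun i => f0 i + ε i) fhat f hmin
  set h := fhat - f with hh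
  set w : ι → ℝ := ∑ j ∈ T, D.mulVec h j • ψ j with hw
  obtain ⟨hq, horth⟩ := hdict h
  have hpyth : ∑ i, (f i - fhat i) ^ 2 = ∑ i, (h - w) i ^ 2 + ∑ i, w i ^ 2 := by
    have h0 := horth _ hq
    have : ∑ i, (f i - fhat i) ^ 2 =
        ∑ i, (h - w) i ^ 2 + ∑ i, w i ^ 2 + 2 * ∑ i, w i * (h - w) i := by
      simp only [Finset.mul_sum, ← Finset.sum_add_distrib]
      refine Finset.sum_congr rfl fun i _ => ?_
      simp only [Pi.sub_apply, hh]
      ring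
    rw [this, h0]
    ring
  have hw0 : 0 ≤ ∑ i, w i ^ 2 := Finset.sum_nonneg fun i _ => sq_nonneg _
  have hnoise : ∑ i, ε i * h i = ∑ i, ε i * w i + ∑ i, ε i * (h - w) i := by
    rw [← Finset.sum_add_distrib]
    refine Finset.sum_congr rfl fun i _ => ?_
    simp only [Pi.sub_apply]
    ring
  have hdual : ∑ i, ε i * w i ≤ c * (∑ j, |D.mulVec fhat j| + ∑ j, |D.mulVec f j|) := by
    have e1 : ∑ i, ε i * w i = ∑ j ∈ T, D.mulVec h j * ∑ i, ψ j i * ε i := by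
      simp only [hw, Finset.sum_apply, Pi.smul_apply, smul_eq_mul, Finset.mul_sum]
      rw [Finset.sum_comm]
      exact Finset.sum_congr rfl fun _ _ => Finset.sum_congr rfl fun _ _ => by ring
    rw [e1, ← Finset.sum_add_distrib, Finset.mul_sum]
    calc _ ≤ ∑ j ∈ T, c * (|D.mulVec fhat j| + |D.mulVec f j|) := by
          refine Finset.sum_le_sum fun j hj => (le_abs_self _).trans ?_
          rw [abs_mul, mul_comm, hh, Matrix.mulVec_sub, Pi.sub_apply]
          exact mul_le_mul (hψ j hj) (abs_sub _ _) (abs_nonneg _) hc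
      _ ≤ _ := Finset.sum_le_sum_of_subset_of_nonneg (Finset.subset_univ T)
          fun j _ _ => by positivity
  have hexp : ∑ i, (fhat i - f0 i) ^ 2 + ∑ i, (f0 i + ε i - f i) ^ 2 =
      ∑ i, (f i - f0 i) ^ 2 + ∑ i, (f0 i + ε i - fhat i) ^ 2 + 2 * ∑ i, ε i * h i := by
    simp only [Finset.mul_sum, ← Finset.sum_add_distrib]
    refine Finset.sum_congr rfl fun i _ => ?_
    simp only [Pi.sub_apply, hh]
    ring
  have := hN _ hq
  linarith

lemma hasSubgaussianMGF_mul_eval_pi_gaussianReal {ι : Type*} [Fintype ι] (a : ℝ) (i : ι) :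
    HasSubgaussianMGF (fun x : ι → ℝ => a * x i) (.mk (a ^ 2) (sq_nonneg a))
      (Measure.pi fun _ : ι => gaussianReal 0 1) := by
  have hid : HasSubgaussianMGF (fun x : ℝ => x) 1 (gaussianReal 0 1) := by
    refine ⟨fun t => integrable_exp_mul_gaussianReal t, fun t => ?_⟩
    have := congrFun (mgf_fun_id_gaussianReal (μ := 0) (v := 1)) t
    simp [this]
  have hev : HasSubgaussianMGF (fun x : ι → ℝ => x i) 1
      (Measure.pi fun _ : ι => gaussianReal 0 1) := by
    refine HasSubgaussianMGF.of_map (X := fun x : ℝ => x) (Y := fun x : ι → ℝ => x i)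
      (measurable_pi_apply i).aemeasurable ?_
    rw [(measurePreserving_eval (fun _ : ι => gaussianReal 0 1) i).map_eq]
    exact hid
  convert hev.const_mul a using 1
  exact (mul_one _).symm

/-- Two-sided Gaussian tail bound for a linear form in standard Gaussian coordinates. -/
lemma measure_pi_gaussianReal_lt_abs_sum_le {ι : Type*} [Fintype ι] (a : ι → ℝ) {τ : ℝ}
    (hτ : 0 ≤ τ) :
    (Measure.pi fun _ : ι => gaussianReal 0 1)
        {x : ι → ℝ | √(∑ i, a i ^ 2) * τ < |∑ i, a i * x i|} ≤
      ENNReal.ofReal (2 * Real.exp (-τ ^ 2 / 2)) := by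
  have hone : ∀ b : ι → ℝ, 0 < ∑ i, b i ^ 2 →
      (Measure.pi fun _ : ι => gaussianReal 0 1)
        {x : ι → ℝ | √(∑ i, b i ^ 2) * τ ≤ ∑ i, b i * x i} ≤
      ENNReal.ofReal (Real.exp (-τ ^ 2 / 2)) := by
    intro b hb
    have hind : iIndepFun (fun i (x : ι → ℝ) => b i * x i)
        (Measure.pi fun _ : ι => gaussianReal 0 1) :=
      iIndepFun_pi (X := fun i (x : ℝ) => b i * x) fun i => by fun_prop
    have := HasSubgaussianMGF.measure_sum_ge_le_of_iIndepFun hind (s := Finset.univ)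
      (fun i _ => hasSubgaussianMGF_mul_eval_pi_gaussianReal (b i) i)
      (ε := √(∑ i, b i ^ 2) * τ) (by positivity)
    rw [← ofReal_measureReal]
    refine ENNReal.ofReal_le_ofReal (this.trans_eq ?_)
    congr 1
    rw [mul_pow, Real.sq_sqrt hb.le, NNReal.coe_sum]
    change -((∑ i, b i ^ 2) * τ ^ 2) / (2 * ∑ i, b i ^ 2) = _
    field_simp
  rcases (Finset.sum_nonneg fun i (_ : i ∈ Finset.univ) => sq_nonneg (a i)).eq_or_lt' with h0 | hpos
  · have hz : ∀ i, a i = 0 := fun i => by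
      simpa using (Finset.sum_eq_zero_iff_of_nonneg fun i _ => sq_nonneg (a i)).1 h0 i
    simp [hz]
  · have hneg := hone (-a) (by simpa using hpos)
    simp only [Pi.neg_apply, neg_sq, neg_mul, Finset.sum_neg_distrib] at hneg
    rw [two_mul, ENNReal.ofReal_add (by positivity) (by positivity)]
    refine (measure_mono fun x hx => ?_).trans
      ((measure_union_le _ _).trans (add_le_add (hone a hpos) hneg))
    rcases lt_abs.1 (Set.mem_ofPred.1 hx) with h | h
    · exact Or.inl h.le
    · exact Or.inr h.le

lemma integral_exp_mul_sq_gaussianReal {c : ℝ} (hc : 0 < c) :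
    ∫ x, Real.exp ((1 - (c⁻¹) ^ 2) / 2 * x ^ 2) ∂gaussianReal 0 1 = c := by
  rw [integral_gaussianReal_eq_integral_smul one_ne_zero]
  simp only [gaussianPDFReal, smul_eq_mul, NNReal.coe_one, mul_one, sub_zero, mul_assoc,
    ← Real.exp_add]
  rw [integral_const_mul]
  have : ∀ x : ℝ, -x ^ 2 / 2 + (1 - (c⁻¹) ^ 2) / 2 * x ^ 2 = -((c⁻¹) ^ 2 / 2) * x ^ 2 := by
    intro x; ring
  simp only [this]
  rw [integral_gaussian, show Real.pi / ((c⁻¹) ^ 2 / 2) = (2 * Real.pi) * c ^ 2 by field_simp,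
    Real.sqrt_mul (by positivity) (c ^ 2), Real.sqrt_sq hc.le]
  have : √(2 * Real.pi) ≠ 0 := by positivity
  field_simp

/-- Chi-square tail bound. -/
lemma measure_pi_gaussianReal_lt_sum_sq_le {ι : Type*} [Fintype ι] {v : ℝ} (hv : 0 ≤ v) :
    (Measure.pi fun _ : ι => gaussianReal 0 1)
        {x : ι → ℝ | (√(Fintype.card ι) + √(2 * v)) ^ 2 < ∑ i, x i ^ 2} ≤
      ENNReal.ofReal (Real.exp (-v)) := by
  rcases isEmpty_or_nonempty ι with hι | hι
  · simp only [Finset.univ_eq_empty, Finset.sum_empty, not_lt.2 (sq_nonneg _)]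
    simp
  set a := √(Fintype.card ι) with ha
  set b := √(2 * v) with hb
  have ha0 : 0 < a := Real.sqrt_pos.2 (by exact_mod_cast Fintype.card_pos)
  have hb0 : 0 ≤ b := Real.sqrt_nonneg _
  have ha2 : a ^ 2 = Fintype.card ι := Real.sq_sqrt (by positivity)
  have hb2 : b ^ 2 = 2 * v := Real.sq_sqrt (by positivity)
  set c := 1 + b / a with hc
  have hc1 : 1 ≤ c := by rw [hc]; linarith [div_nonneg hb0 ha0.le]
  set t := (1 - (c⁻¹) ^ 2) / 2 with ht
  have ht0 : 0 ≤ t := by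
    have : c⁻¹ ^ 2 ≤ 1 := pow_le_one₀ (by positivity) (inv_le_one_of_one_le₀ hc1)
    linarith
  have hexp : ∀ x : ι → ℝ, Real.exp (t * ∑ i, x i ^ 2) = ∏ i, Real.exp (t * x i ^ 2) := by
    intro x
    rw [Finset.mul_sum, Real.exp_sum]
  have hmgf : mgf (fun x : ι → ℝ => ∑ i, x i ^ 2) (Measure.pi fun _ : ι => gaussianReal 0 1) t =
      c ^ Fintype.card ι := by
    simp only [mgf, hexp]
    rw [integral_fintype_prod_eq_prod (f := fun (_ : ι) (y : ℝ) => Real.exp (t * y ^ 2))]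
    rw [ht, Finset.prod_const, integral_exp_mul_sq_gaussianReal (by linarith), Finset.card_univ]
  have hint : Integrable (fun x : ι → ℝ => Real.exp (t * ∑ i, x i ^ 2))
      (Measure.pi fun _ : ι => gaussianReal 0 1) := by
    refine not_imp_comm.1 integral_undef (ne_of_gt ?_)
    change 0 < mgf (fun x : ι → ℝ => ∑ i, x i ^ 2) (Measure.pi fun _ : ι => gaussianReal 0 1) t
    rw [hmgf]
    positivity
  have hch := measure_ge_le_exp_mul_mgf ((a + b) ^ 2) ht0 hint
  refine (measure_mono (t := {x : ι → ℝ | (a + b) ^ 2 ≤ ∑ i, x i ^ 2})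
    fun x hx => Set.mem_ofPred.2 (Set.mem_ofPred.1 hx).le).trans ?_
  rw [← ofReal_measureReal]
  refine ENNReal.ofReal_le_ofReal (hch.trans ?_)
  rw [hmgf]
  calc Real.exp (-t * (a + b) ^ 2) * c ^ Fintype.card ι
      ≤ Real.exp (-t * (a + b) ^ 2) * Real.exp (b / a) ^ Fintype.card ι := by
        gcongr
        rw [hc, add_comm]
        exact Real.add_one_le_exp _
    _ = Real.exp (-v) := by
        rw [← Real.exp_nat_mul, ← Real.exp_add, ← ha2]
        congr 1
        have h1 : (a + b) ^ 2 * c⁻¹ ^ 2 = a ^ 2 := by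
          rw [hc]
          field_simp
        have h2 : a ^ 2 * (b / a) = a * b := by field_simp
        rw [h2, ht]
        linear_combination (1 / 2) * h1 - (1 / 2) * hb2

/-- The orthogonal projection of a standard Gaussian vector is a standard Gaussian vector. -/
lemma stdGaussian_map_orthogonalProjectionOnto {E : Type*} [NormedAddCommGroup E]
    [InnerProductSpace ℝ E] [FiniteDimensional ℝ E] [MeasurableSpace E] [BorelSpace E]
    (K : Submodule ℝ E) :
    (stdGaussian E).map K.orthogonalProjectionOnto = stdGaussian K := by
  apply Measure.ext_of_charFun
  ext t
  rw [charFun_stdGaussian, charFun_apply, integral_map (by fun_prop) (by fun_prop)]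
  have : ∀ x : E, inner ℝ (K.orthogonalProjectionOnto x) t = inner ℝ x (t : E) := fun x => by
    simp
  simp only [this]
  rw [← charFun_apply, charFun_stdGaussian, Submodule.coe_norm]

lemma stdGaussian_lt_norm_sq_le {E : Type*} [NormedAddCommGroup E]
    [InnerProductSpace ℝ E] [FiniteDimensional ℝ E] [MeasurableSpace E] [BorelSpace E]
    {v : ℝ} (hv : 0 ≤ v) :
    stdGaussian E {x | (√(Module.finrank ℝ E) + √(2 * v)) ^ 2 < ‖x‖ ^ 2} ≤
      ENNReal.ofReal (Real.exp (-v)) := by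
  rw [stdGaussian, Measure.map_apply (by fun_prop) (measurableSet_lt (by fun_prop) (by fun_prop))]
  refine (measure_mono fun x hx => ?_).trans
    (measure_pi_gaussianReal_lt_sum_sq_le (ι := Fin (Module.finrank ℝ E)) hv)
  have h : ‖∑ i, x i • stdOrthonormalBasis ℝ E i‖ ^ 2 = ∑ i, x i ^ 2 := by
    rw [← (stdOrthonormalBasis ℝ E).sum_sq_norm_inner_right]
    simp [inner_sum, inner_smul_right, (stdOrthonormalBasis ℝ E).inner_eq_ite]
  simpa [h] using hx

/-- With high probability, linear forms in Gaussian noise indexed by a subspace are controlled by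
the dimension of the subspace. -/
lemma measure_pi_gaussianReal_subspace_le {ι : Type*} [Fintype ι] (N : Submodule ℝ (ι → ℝ))
    {v : ℝ} (hv : 0 ≤ v) :
    (Measure.pi fun _ : ι => gaussianReal 0 1)
        {x : ι → ℝ | ¬ ∀ q ∈ N, 2 * ∑ i, x i * q i ≤
          (√(Module.finrank ℝ N) + √(2 * v)) ^ 2 + ∑ i, q i ^ 2} ≤
      ENNReal.ofReal (Real.exp (-v)) := by
  set e := (WithLp.linearEquiv 2 ℝ (ι → ℝ)).symm with he
  set K : Submodule ℝ (EuclideanSpace ℝ ι) := N.map (e : (ι → ℝ) →ₗ[ℝ] EuclideanSpace ℝ ι) with hK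
  have hr : Module.finrank ℝ K = Module.finrank ℝ N := LinearEquiv.finrank_map_eq e N
  have hmain := stdGaussian_lt_norm_sq_le (E := K) hv
  rw [← stdGaussian_map_orthogonalProjectionOnto K, ← map_pi_eq_stdGaussian,
    Measure.map_map (by fun_prop) (by fun_prop), Measure.map_apply (by fun_prop)
      (measurableSet_lt (by fun_prop) (by fun_prop)), hr] at hmain
  refine (measure_mono fun x hx => ?_).trans hmain
  by_contra hle
  refine hx fun q hq => ?_
  simp only [Set.mem_preimage, Set.mem_ofPred_eq, Function.comp_apply, not_lt] at hle
  set p := K.orthogonalProjectionOnto (WithLp.toLp 2 x) with hp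
  set q' : K := ⟨e q, Submodule.mem_map_of_mem hq⟩ with hq'
  have h1 : ∑ i, x i * q i = inner ℝ p q' := by
    simp [hp, hq', he, PiLp.inner_apply, mul_comm]
  have h2 : ∑ i, q i ^ 2 = ‖q'‖ ^ 2 := by
    simp [hq', he, EuclideanSpace.real_norm_sq_eq]
  rw [h1, h2]
  have := norm_sub_sq_real p q'
  nlinarith [sq_nonneg ‖p - q'‖]

/-- non-adaptive bound of Theorem 2.2: for the analysis estimator
`f̂ ∈ argmin ‖Y - g‖ₙ² + 2λ‖Dg‖₁` with `Y = f⁰ + ε`, `ε` having i.i.d. `N(0,1)` coordinates,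
if `λ ≥ max_{j ∉ S} ‖ψⱼ^{-S}‖ₙ · λ₀(u)`, then with probability at least `1 - e^{-u} - e^{-v}`,
`‖f̂ - f⁰‖ₙ² ≤ ‖f - f⁰‖ₙ² + 4λ‖Df‖₁ + (√(r̄_S/n) + √(2v/n))²`. -/
theorem stmt_0
    (n m : ℕ) (hn : 0 < n) (hm : 0 < m)
    (D : Matrix (Fin m) (Fin n) ℝ)
    (S : Finset (Fin m)) (hs : S.card < m)
    -- `Nbar` is a linear subspace containing `N_{-S} = {f : (Df)_j = 0 ∀ j ∉ S}`
    (Nbar : Submodule ℝ (Fin n → ℝ))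
    (hsub : ∀ f : Fin n → ℝ, (∀ j, j ∉ S → D.mulVec f j = 0) → f ∈ Nbar)
    -- `ψ` is a dictionary for `Nbar`: for every `f`, the orthogonal projection of `f`
    -- onto the orthogonal complement of `Nbar` is `∑_{j ∉ S} (Df)_j • ψ_j`
    (ψ : Fin m → (Fin n → ℝ))
    (hdict : ∀ f : Fin n → ℝ,
      f - (∑ j ∈ Sᶜ, D.mulVec f j • ψ j) ∈ Nbar ∧
      ∀ g ∈ Nbar, (∑ i, (∑ j ∈ Sᶜ, D.mulVec f j • ψ j) i * g i) = 0)
    (f0 : Fin n → ℝ)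
    (u v lam : ℝ) (hu : 0 < u) (hv : 0 < v) (hlam : 0 < lam)
    -- `λ ≥ max_{j ∉ S} ‖ψⱼ‖ₙ λ₀(u)` with `λ₀(u) = √((2 log(2(m-s)) + 2u)/n)`
    (hlam2 : ∀ j, j ∉ S →
      Real.sqrt ((∑ i, ψ j i ^ 2) / n) *
        Real.sqrt ((2 * Real.log (2 * ((m : ℝ) - S.card)) + 2 * u) / n) ≤ lam)
    (f : Fin n → ℝ) :
    ENNReal.ofReal (1 - Real.exp (-u) - Real.exp (-v)) ≤
      (Measure.pi fun _ : Fin n => gaussianReal 0 1)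
        {ε : Fin n → ℝ |
          ∀ fhat : Fin n → ℝ,
            (∀ g : Fin n → ℝ,
              (∑ i, (f0 i + ε i - fhat i) ^ 2) / n
                  + 2 * lam * ∑ j, |D.mulVec fhat j| ≤
                (∑ i, (f0 i + ε i - g i) ^ 2) / n
                  + 2 * lam * ∑ j, |D.mulVec g j|) →
            (∑ i, (fhat i - f0 i) ^ 2) / n ≤
              (∑ i, (f i - f0 i) ^ 2) / n
                + 4 * lam * ∑ j, |D.mulVec f j|
                + (Real.sqrt ((Module.finrank ℝ Nbar : ℝ) / n)
                    + Real.sqrt (2 * v / n)) ^ 2} := by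
  have hn' : (0 : ℝ) < n := by exact_mod_cast hn
  set μ := Measure.pi fun _ : Fin n => gaussianReal 0 1 with hμ
  set k : ℝ := (m : ℝ) - S.card with hk
  have hk1 : 1 ≤ k := by
    have : (S.card : ℝ) + 1 ≤ m := by exact_mod_cast hs
    linarith
  have hcard : ((Sᶜ : Finset (Fin m)).card : ℝ) = k := by
    rw [Finset.card_compl, Fintype.card_fin, Nat.cast_sub hs.le]
  set L := 2 * Real.log (2 * k) + 2 * u with hL
  have hL0 : 0 ≤ L := by
    have := Real.log_nonneg (show 1 ≤ 2 * k by linarith)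
    positivity
  have hdictEvent : ∀ j ∈ Sᶜ, μ {x | lam * n < |∑ i, ψ j i * x i|} ≤
      ENNReal.ofReal (Real.exp (-u) / k) := by
    intro j hj
    have hle : √(∑ i, ψ j i ^ 2) * √L ≤ lam * n := by
      have h := hlam2 j (Finset.mem_compl.1 hj)
      rw [Real.sqrt_div' _ hn'.le, Real.sqrt_div' _ hn'.le, div_mul_div_comm,
        Real.mul_self_sqrt hn'.le, div_le_iff₀ hn'] at h
      exact h
    refine (measure_mono fun x hx => hle.trans_lt hx).trans
      ((measure_pi_gaussianReal_lt_abs_sum_le (ψ j) (Real.sqrt_nonneg L)).trans_eq ?_)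
    rw [Real.sq_sqrt hL0, show -L / 2 = -u - Real.log (2 * k) by rw [hL]; ring, Real.exp_sub,
      Real.exp_log (by positivity)]
    congr 1
    field_simp
  have hunion : μ (⋃ j ∈ Sᶜ, {x | lam * n < |∑ i, ψ j i * x i|}) ≤
      ENNReal.ofReal (Real.exp (-u)) := by
    refine (measure_biUnion_finset_le _ _).trans ((Finset.sum_le_sum hdictEvent).trans_eq ?_)
    rw [Finset.sum_const, ← ENNReal.ofReal_nsmul, nsmul_eq_mul, hcard]
    congr 1
    field_simp
  have hproj := measure_pi_gaussianReal_subspace_le Nbar hv.le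
  rw [← hμ] at hproj
  rw [sub_sub, ENNReal.ofReal_sub _ (by positivity), ENNReal.ofReal_one, tsub_le_iff_right,
    ENNReal.ofReal_add (by positivity) (by positivity), ← measure_univ (μ := μ)]
  refine (measure_mono fun x _ => ?_).trans ((measure_union_le _ _).trans
    (add_le_add le_rfl ((measure_union_le _ _).trans (add_le_add hunion hproj))))
  by_cases h1 : x ∈ ⋃ j ∈ Sᶜ, {x | lam * n < |∑ i, ψ j i * x i|}
  · exact Or.inr (Or.inl h1)
  by_cases h2 : ∀ q ∈ Nbar, 2 * ∑ i, x i * q i ≤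
      (√(Module.finrank ℝ Nbar) + √(2 * v)) ^ 2 + ∑ i, q i ^ 2
  swap
  · exact Or.inr (Or.inr h2)
  refine Or.inl fun fhat hmin => ?_
  simp only [Set.mem_iUnion, Set.mem_ofPred_eq, not_exists, not_lt] at h1
  have h := analysis_oracle_inequality D Sᶜ Nbar ψ hdict (by positivity) f0 x fhat f h1 h2
    fun g => by
      have := mul_le_mul_of_nonneg_right (hmin g) hn'.le
      rw [add_mul, add_mul, div_mul_cancel₀ _ hn'.ne', div_mul_cancel₀ _ hn'.ne'] at this
      linarith
  rw [Real.sqrt_div' _ hn'.le, Real.sqrt_div' _ hn'.le, ← add_div, div_pow,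
    Real.sq_sqrt hn'.le, div_le_iff₀ hn', add_mul, add_mul, div_mul_cancel₀ _ hn'.ne',
    div_mul_cancel₀ _ hn'.ne']
  linarith
end

section
/- Let n, k be integers with 1 ≤ k ≤ n−1, assume Δ(k)·Δ(k)ᵀ is invertible, and let ψ_j^𝒟 denote the j-th column of the Moore–Penrose pseudoinverse Δ(k)⁺ = Δ(k)ᵀ(Δ(k)Δ(k)ᵀ)⁻¹ ∈ ℝ^{n×(n−k)}, for j ∈ {k+1,…,n}. Then for all j ∈ {k+1,…,n−1}, ‖ψ_j^𝒟‖₂² ≤ min((j−k)^{2k−1}, (n+1−j)^{2k−1}). -/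
open Finset Matrix

/-- The `k`-th order difference operator `Δ(k) ∈ ℝ^{(n-k)×n}`: rows are indexed by
`i ∈ {k+1,…,n}` (here row `r : Fin (n-k)` corresponds to `i = r + k + 1`), columns by
`j ∈ {1,…,n}` (column `c : Fin n` corresponds to `j = c + 1`), and
`Δ(k)_{ij} = (-1)^l * binom(k,l)` if `j = i - l` with `0 ≤ l ≤ k`, else `0`. -/
def Delta (n k : ℕ) : Matrix (Fin (n - k)) (Fin n) ℝ :=
  Matrix.of fun r c =>
    if (r : ℕ) ≤ (c : ℕ) ∧ (c : ℕ) ≤ k + (r : ℕ) then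
      (-1 : ℝ) ^ (k + (r : ℕ) - (c : ℕ)) * (k.choose (k + (r : ℕ) - (c : ℕ)) : ℝ)
    else 0

/-- The Moore–Penrose pseudoinverse `Δ(k)⁺ = Δ(k)ᵀ (Δ(k)Δ(k)ᵀ)⁻¹ ∈ ℝ^{n×(n-k)}`;
its column with index `r : Fin (n-k)` is `ψ_j^𝒟` for `j = r + k + 1 ∈ {k+1,…,n}`. -/
noncomputable def DeltaPinv (n k : ℕ) : Matrix (Fin n) (Fin (n - k)) ℝ :=
  (Delta n k)ᵀ * (Delta n k * (Delta n k)ᵀ)⁻¹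

open scoped fwdDiff

/-- The truncated binomial `x ↦ binom(x + j, j)`, extended by zero to the negative integers. -/
noncomputable def truncChoose (j : ℕ) (x : ℤ) : ℝ :=
  if 0 ≤ x then ((x.toNat + j).choose j : ℝ) else 0

lemma truncChoose_succ_sub (j : ℕ) (x : ℤ) :
    truncChoose (j + 1) (x + 1) - truncChoose (j + 1) x = truncChoose j (x + 1) := by
  unfold truncChoose
  rcases lt_trichotomy x (-1) with h | rfl | h
  · rw [if_neg (by omega), if_neg (by omega), if_neg (by omega), sub_zero]
  · simp
  · rw [if_pos (by omega), if_pos (by omega), if_pos (by omega)]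
    obtain ⟨m, rfl⟩ := Int.eq_ofNat_of_zero_le (show 0 ≤ x by omega)
    have h1 : ((m : ℤ) + 1).toNat = m + 1 := by omega
    rw [h1, Int.toNat_natCast, show m + 1 + (j + 1) = (m + 1 + j) + 1 by ring,
      Nat.choose_succ_succ, show m + (j + 1) = m + 1 + j by ring]
    push_cast
    ring

lemma truncChoose_zero (x : ℤ) : truncChoose 0 x = if 0 ≤ x then 1 else 0 := by
  simp [truncChoose]

lemma fwdDiff_iter_truncChoose_add (j : ℕ) (b x : ℤ) :
    (Δ_[1])^[j + 1] (fun y : ℤ => truncChoose j (y + b)) x =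
      if x + b = -(j + 1 : ℤ) then 1 else 0 := by
  induction j generalizing b with
  | zero =>
    simp only [zero_add, Function.iterate_one, fwdDiff, truncChoose_zero]
    split_ifs <;> first | omega | norm_num
  | succ j ih =>
    have h : Δ_[1] (fun y : ℤ => truncChoose (j + 1) (y + b)) =
        fun y : ℤ => truncChoose j (y + (b + 1)) := by
      funext y
      rw [fwdDiff, add_right_comm, truncChoose_succ_sub, add_assoc]
    rw [Function.iterate_succ_apply, h, ih]
    congr 1
    push_cast
    exact propext ⟨fun _ => by omega, fun _ => by omega⟩

lemma fwdDiff_iter_truncChoose_sub (j : ℕ) (b x : ℤ) :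
    (Δ_[1])^[j + 1] (fun y : ℤ => (-1) ^ (j + 1) * truncChoose j (b - y)) x =
      if x = b then 1 else 0 := by
  induction j with
  | zero =>
    simp only [zero_add, Function.iterate_one, fwdDiff, truncChoose_zero]
    split_ifs <;> first | omega | norm_num
  | succ j ih =>
    have h : Δ_[1] (fun y : ℤ => (-1) ^ (j + 1 + 1) * truncChoose (j + 1) (b - y)) =
        fun y : ℤ => (-1) ^ (j + 1) * truncChoose j (b - y) := by
      funext y
      have := truncChoose_succ_sub j (b - (y + 1))
      rw [show b - (y + 1) + 1 = b - y by ring] at this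
      rw [fwdDiff, ← this]
      ring
    rw [Function.iterate_succ_apply, h, ih]

lemma truncChoose_sq_le (j N : ℕ) (x : ℤ) (hx : x < N) :
    truncChoose j x ^ 2 ≤ if 0 ≤ x then (N : ℝ) ^ (2 * j) else 0 := by
  unfold truncChoose
  split_ifs with h
  · rw [mul_comm, pow_mul]
    have h1 : (x.toNat + j).choose j ≤ N ^ j :=
      (Nat.choose_add_le_add_one_pow _ _).trans (Nat.pow_le_pow_left (by omega) _)
    exact pow_le_pow_left₀ (Nat.cast_nonneg _) (mod_cast h1) 2
  · simp

lemma Delta_mulVec (n k : ℕ) (f : ℤ → ℝ) (s : Fin (n - k)) :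
    (Delta n k *ᵥ fun c : Fin n => f (c : ℕ)) s = (Δ_[1])^[k] f (s : ℕ) := by
  have hs := s.2
  rw [fwdDiff_iter_eq_sum_shift]
  simp only [mulVec, dotProduct, Delta, Matrix.of_apply]
  rw [Fin.sum_univ_eq_sum_range (fun c => (if (s : ℕ) ≤ c ∧ c ≤ k + s then
    (-1 : ℝ) ^ (k + (s : ℕ) - c) * (k.choose (k + (s : ℕ) - c) : ℝ) else 0) * f c)]
  simp only [ite_mul, zero_mul]
  rw [← sum_filter]
  symm
  refine sum_bij (fun q _ => (s : ℕ) + q) ?_ ?_ ?_ ?_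
  · intro q hq
    simp only [mem_range, mem_filter] at hq ⊢
    omega
  · intro a _ b _ h
    omega
  · intro c hc
    simp only [mem_range, mem_filter] at hc
    exact ⟨c - s, by simp only [mem_range]; omega, by omega⟩
  · intro q hq
    have hq' : q ≤ k := by simpa [Nat.lt_succ_iff] using hq
    rw [show k + (s : ℕ) - (s + q) = k - q by omega, Nat.choose_symm hq']
    simp

/-- The columns of the pseudoinverse are minimal-norm solutions. -/
lemma sum_sq_DeltaPinv_le {n k : ℕ} (hinv : IsUnit (Delta n k * (Delta n k)ᵀ).det)
    (r : Fin (n - k)) (f : Fin n → ℝ) (hf : Delta n k *ᵥ f = Pi.single r 1) :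
    ∑ i, DeltaPinv n k i r ^ 2 ≤ ∑ i, f i ^ 2 := by
  set D := Delta n k
  set p : Fin n → ℝ := fun i => DeltaPinv n k i r with hp
  have hpe : p = Dᵀ *ᵥ ((D * Dᵀ)⁻¹ *ᵥ Pi.single r 1) := by
    rw [mulVec_mulVec, mulVec_single_one]
    rfl
  have hDp : D *ᵥ p = Pi.single r 1 := by
    rw [hpe, mulVec_mulVec, mulVec_mulVec, mul_nonsing_inv _ hinv, one_mulVec]
  have key : (f - p) ⬝ᵥ p = 0 := by
    conv_lhs => rw [hpe]
    rw [dotProduct_mulVec, vecMul_transpose, ← hpe, mulVec_sub, hf, hDp, sub_self,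
      zero_dotProduct]
  have hsum : ∑ i, f i ^ 2 = ∑ i, p i ^ 2 + ∑ i, (f i - p i) ^ 2 + 2 * ((f - p) ⬝ᵥ p) := by
    rw [dotProduct, mul_sum, ← sum_add_distrib, ← sum_add_distrib]
    refine sum_congr rfl fun i _ => ?_
    simp only [Pi.sub_apply]
    ring
  rw [hsum, key]
  have : 0 ≤ ∑ i, (f i - p i) ^ 2 := sum_nonneg fun i _ => sq_nonneg _
  linarith

lemma sum_sq_DeltaPinv_le_pow_left {n j : ℕ}
    (hinv : IsUnit (Delta n (j + 1) * (Delta n (j + 1))ᵀ).det) (r : Fin (n - (j + 1))) :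
    ∑ i, DeltaPinv n (j + 1) i r ^ 2 ≤ ((r + 1 : ℕ) : ℝ) ^ (2 * j + 1) := by
  have hr := r.2
  refine (sum_sq_DeltaPinv_le hinv r (fun c => (-1) ^ (j + 1) *
    truncChoose j ((r : ℕ) - (c : ℕ) : ℤ)) ?_).trans ?_
  · funext s
    rw [Delta_mulVec n (j + 1) (fun y => (-1) ^ (j + 1) * truncChoose j ((r : ℕ) - y)),
      fwdDiff_iter_truncChoose_sub, Pi.single_apply]
    simp [Fin.ext_iff]
  · have h (c : Fin n) : ((-1) ^ (j + 1) * truncChoose j ((r : ℕ) - (c : ℕ) : ℤ)) ^ 2 ≤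
        if (c : ℕ) ≤ r then ((r + 1 : ℕ) : ℝ) ^ (2 * j) else 0 := by
      rw [mul_pow, ← pow_mul, mul_comm (j + 1), pow_mul, neg_one_sq, one_pow, one_mul]
      simpa using truncChoose_sq_le j (r + 1) ((r : ℕ) - (c : ℕ)) (by push_cast; omega)
    refine (sum_le_sum fun c _ => h c).trans_eq ?_
    rw [Fin.sum_univ_eq_sum_range (fun c => if c ≤ (r : ℕ) then
      ((r + 1 : ℕ) : ℝ) ^ (2 * j) else 0), ← sum_filter, sum_const,
      show (range n).filter (· ≤ (r : ℕ)) = range (r + 1) by ext c; simp; omega,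
      card_range, nsmul_eq_mul]
    ring

lemma sum_sq_DeltaPinv_le_pow_right {n j : ℕ}
    (hinv : IsUnit (Delta n (j + 1) * (Delta n (j + 1))ᵀ).det) (r : Fin (n - (j + 1))) :
    ∑ i, DeltaPinv n (j + 1) i r ^ 2 ≤ ((n - (r + (j + 1)) : ℕ) : ℝ) ^ (2 * j + 1) := by
  have hr := r.2
  refine (sum_sq_DeltaPinv_le hinv r (fun c => truncChoose j
    ((c : ℕ) + -((r : ℕ) + (j + 1)) : ℤ)) ?_).trans ?_
  · funext s
    rw [Delta_mulVec n (j + 1) (fun y => truncChoose j (y + -((r : ℕ) + (j + 1)))),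
      fwdDiff_iter_truncChoose_add, Pi.single_apply]
    congr 1
    exact propext ⟨fun _ => by omega, fun h => by subst h; omega⟩
  · have h (c : Fin n) : truncChoose j ((c : ℕ) + -((r : ℕ) + (j + 1)) : ℤ) ^ 2 ≤
        if r + (j + 1) ≤ (c : ℕ) then ((n - (r + (j + 1)) : ℕ) : ℝ) ^ (2 * j) else 0 := by
      refine (truncChoose_sq_le j (n - (r + (j + 1))) _ (by omega)).trans_eq ?_
      congr 1
      exact propext ⟨fun _ => by omega, fun _ => by omega⟩
    refine (sum_le_sum fun c _ => h c).trans_eq ?_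
    rw [Fin.sum_univ_eq_sum_range (fun c => if r + (j + 1) ≤ c then
      ((n - (r + (j + 1)) : ℕ) : ℝ) ^ (2 * j) else 0), ← sum_filter, sum_const,
      show (range n).filter (r + (j + 1) ≤ ·) = Ico (r + (j + 1)) n by
        ext c; simp only [mem_filter, mem_range, mem_Ico]; omega,
      Nat.card_Ico, nsmul_eq_mul]
    ring

/-- Lemma 3.1: for `j ∈ {k+1,…,n-1}`,
`‖ψ_j^𝒟‖₂² ≤ min((j-k)^{2k-1}, (n+1-j)^{2k-1})`. -/
theorem stmt_4
    (n k : ℕ) (hk : 1 ≤ k) (hkn : k ≤ n - 1)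
    (hinv : IsUnit (Delta n k * (Delta n k)ᵀ).det) :
    ∀ (j : ℕ) (hj1 : k + 1 ≤ j) (hj2 : j ≤ n - 1),
      (∑ i, (DeltaPinv n k i ⟨j - (k + 1), by omega⟩) ^ 2) ≤
        min (((j : ℝ) - k) ^ (2 * k - 1)) (((n : ℝ) + 1 - j) ^ (2 * k - 1)) := by
  intro j hj1 hj2
  obtain ⟨k, rfl⟩ := Nat.exists_eq_add_of_le' hk
  rw [show 2 * (k + 1) - 1 = 2 * k + 1 by omega]
  refine le_min ?_ ?_
  · refine (sum_sq_DeltaPinv_le_pow_left hinv _).trans_eq (congrArg (· ^ (2 * k + 1)) ?_)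
    rw [← Nat.cast_sub (by omega)]
    exact congrArg _ (by simp only; omega)
  · refine (sum_sq_DeltaPinv_le_pow_right hinv _).trans_eq (congrArg (· ^ (2 * k + 1)) ?_)
    rw [← Nat.cast_succ, ← Nat.cast_sub (by omega)]
    exact congrArg _ (by simp only; omega)
end

section
/- Let n ≥ 3, assume Δ(2)·Δ(2)ᵀ is invertible, and let ψ_j^𝒟 denote the j-th column of the Moore–Penrose pseudoinverse Δ(2)⁺ = Δ(2)ᵀ(Δ(2)Δ(2)ᵀ)⁻¹ ∈ ℝ^{n×(n−2)}, for j ∈ {3,…,n}. Then for all j ∈ {3,…,n}, ‖ψ_j^𝒟‖₂² = (n−j+1)(n−j+2)(j−2)(j−1)·(2j(n−j+3) − 3(n+1)) / (6n(n+1)(n−1)). -/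
open Finset Matrix

lemma sum_range_ite_add_eq (m k c : ℕ) (g : ℕ → ℝ) :
    ∑ r ∈ range m, (if c = r + k then g r else 0) =
      if k ≤ c ∧ c < m + k then g (c - k) else 0 := by
  split_ifs with h
  · rw [Finset.sum_eq_single (c - k)]
    · rw [if_pos (by omega)]
    · intro b _ hb
      rw [if_neg (by omega)]
    · intro hc
      exact absurd (Finset.mem_range.2 (by omega)) hc
  · refine Finset.sum_eq_zero fun r hr => if_neg ?_
    have := Finset.mem_range.1 hr
    omega

lemma Delta_two_apply (n : ℕ) (r : Fin (n - 2)) (c : Fin n) :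
    Delta n 2 r c = (if (c : ℕ) = r then 1 else 0) - 2 * (if (c : ℕ) = r + 1 then 1 else 0)
      + (if (c : ℕ) = r + 2 then 1 else 0) := by
  obtain ⟨r, hr⟩ := r
  obtain ⟨c, hc⟩ := c
  simp only [Delta, Matrix.of_apply]
  by_cases h : r ≤ c ∧ c ≤ 2 + r
  · obtain rfl | rfl | rfl : c = r ∨ c = r + 1 ∨ c = r + 2 := by omega
    · simp
    · simp [show 2 + r - (r + 1) = 1 by omega, show r + 1 ≤ 2 + r by omega]
    · simp [show 2 + r - (r + 2) = 0 by omega, show r + 2 ≤ 2 + r by omega]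
  · rw [if_neg h, if_neg (by omega), if_neg (by omega), if_neg (by omega)]
    simp

lemma Delta_two_mulVec (n : ℕ) (f : ℕ → ℝ) (r : Fin (n - 2)) :
    (Delta n 2 *ᵥ fun c => f c) r = f r - 2 * f (r + 1) + f (r + 2) := by
  have hr := r.isLt
  have key (k : ℕ) (hk : k ≤ 2) :
      ∑ c : Fin n, (if (c : ℕ) = r + k then f c else 0) = f (r + k) := by
    rw [Fin.sum_univ_eq_sum_range (fun c => if c = (r : ℕ) + k then f c else 0) n,
      Finset.sum_ite_eq' (range n), if_pos (Finset.mem_range.2 (by omega))]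
  have e0 := key 0 (by omega)
  simp only [Nat.add_zero] at e0
  simp only [Matrix.mulVec, dotProduct, Delta_two_apply, sub_mul, add_mul, mul_assoc, ite_mul,
    one_mul, zero_mul, Finset.sum_add_distrib, Finset.sum_sub_distrib, ← Finset.mul_sum]
  rw [e0, key 1 (by omega), key 2 (by omega)]

lemma Delta_two_transpose_mulVec (n : ℕ) (V : ℕ → ℝ) (h0 : V 0 = 0) (h1 : V 1 = 0)
    (hn : V n = 0) (hn' : V (n + 1) = 0) (c : Fin n) :
    ((Delta n 2)ᵀ *ᵥ fun r => V (r + 2)) c = V (c + 2) - 2 * V (c + 1) + V c := by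
  have hc := c.isLt
  have key (k : ℕ) (hk : k ≤ 2) :
      ∑ r : Fin (n - 2), (if (c : ℕ) = r + k then V (r + 2) else 0) = V (c + 2 - k) := by
    rw [Fin.sum_univ_eq_sum_range (fun r => if (c : ℕ) = r + k then V (r + 2) else 0) (n - 2),
      sum_range_ite_add_eq (n - 2) k c fun r => V (r + 2)]
    split_ifs with h
    · congr 1
      omega
    · obtain h | h | h | h :
        c + 2 - k = 0 ∨ c + 2 - k = 1 ∨ c + 2 - k = n ∨ c + 2 - k = n + 1 := by omega
      all_goals rw [h]; symm; assumption
  have e0 := key 0 (by omega)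
  simp only [Nat.add_zero] at e0
  simp only [Matrix.mulVec, dotProduct, Matrix.transpose_apply, Delta_two_apply, sub_mul, add_mul,
    mul_assoc, ite_mul, one_mul, zero_mul, Finset.sum_add_distrib, Finset.sum_sub_distrib,
    ← Finset.mul_sum]
  rw [e0, key 1 (by omega), key 2 (by omega)]
  rfl

lemma sum_DeltaPinv_sq (n k : ℕ) (hinv : IsUnit (Delta n k * (Delta n k)ᵀ).det)
    (j : Fin (n - k)) (w : Fin (n - k) → ℝ)
    (hw : Delta n k *ᵥ ((Delta n k)ᵀ *ᵥ w) = Pi.single j 1) :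
    ∑ i, DeltaPinv n k i j ^ 2 = w j := by
  have hcol : (fun i => DeltaPinv n k i j) = (Delta n k)ᵀ *ᵥ w := by
    have h : (fun i => DeltaPinv n k i j) = DeltaPinv n k *ᵥ Pi.single j 1 := by
      ext i
      simp
    rw [h, ← hw, DeltaPinv, Matrix.mulVec_mulVec w, Matrix.mulVec_mulVec,
      Matrix.nonsing_inv_mul_cancel_right _ _ hinv]
  calc ∑ i, DeltaPinv n k i j ^ 2
      = (fun i => DeltaPinv n k i j) ⬝ᵥ fun i => DeltaPinv n k i j := by
        simp [dotProduct, sq]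
    _ = w ⬝ᵥ (Delta n k *ᵥ ((Delta n k)ᵀ *ᵥ w)) := by
        rw [hcol, Matrix.dotProduct_mulVec w, Matrix.mulVec_transpose]
    _ = w j := by rw [hw]; simp

/-- For suitable `a` and `b`, the discrete Green function of the fourth difference operator
with source at `p`, vanishing at `0` and `1`. -/
noncomputable def cubicGreen (a b : ℝ) (p x : ℕ) : ℝ :=
  x * (x - 1) * (a * x + b) +
    if p ≤ x then ((x : ℝ) - p + 1) * (x - p) * (x - p - 1) / 6 else 0

lemma fourth_difference_cubicGreen (a b : ℝ) (p r : ℕ) :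
    (cubicGreen a b p (r + 2) - 2 * cubicGreen a b p (r + 1) + cubicGreen a b p r)
      - 2 * (cubicGreen a b p (r + 3) - 2 * cubicGreen a b p (r + 2) + cubicGreen a b p (r + 1))
      + (cubicGreen a b p (r + 4) - 2 * cubicGreen a b p (r + 3) + cubicGreen a b p (r + 2)) =
      if r + 2 = p then 1 else 0 := by
  unfold cubicGreen
  obtain h | h | rfl | h | h | h :
      p ≤ r ∨ p = r + 1 ∨ r + 2 = p ∨ p = r + 3 ∨ p = r + 4 ∨ r + 4 < p := by omega
  · simp [show p ≤ r by omega, show p ≤ r + 1 by omega, show p ≤ r + 2 by omega,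
      show p ≤ r + 3 by omega, show p ≤ r + 4 by omega, show ¬ r + 2 = p by omega]
    ring
  · subst h; simp; ring
  · simp; ring
  · subst h; simp; ring
  · subst h; simp; ring
  · simp [show ¬ p ≤ r by omega, show ¬ p ≤ r + 1 by omega, show ¬ p ≤ r + 2 by omega,
      show ¬ p ≤ r + 3 by omega, show ¬ p ≤ r + 4 by omega, show ¬ r + 2 = p by omega]
    ring

/-- Lemma 3.2: for `k = 2` and `j ∈ {3,…,n}`,
`‖ψ_j^𝒟‖₂² = (n-j+1)(n-j+2)(j-2)(j-1)(2j(n-j+3) - 3(n+1)) / (6n(n+1)(n-1))`. -/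
theorem stmt_5
    (n : ℕ) (hn : 3 ≤ n)
    (hinv : IsUnit (Delta n 2 * (Delta n 2)ᵀ).det) :
    ∀ (j : ℕ) (hj1 : 3 ≤ j) (hj2 : j ≤ n),
      (∑ i, (DeltaPinv n 2 i ⟨j - 3, by omega⟩) ^ 2) =
        ((n : ℝ) - j + 1) * ((n : ℝ) - j + 2) * ((j : ℝ) - 2) * ((j : ℝ) - 1) *
            (2 * (j : ℝ) * ((n : ℝ) - j + 3) - 3 * ((n : ℝ) + 1)) /
          (6 * (n : ℝ) * ((n : ℝ) + 1) * ((n : ℝ) - 1)) := by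
  intro j hj1 hj2
  obtain ⟨q, rfl⟩ : ∃ q, j = q + 3 := ⟨j - 3, by omega⟩
  have hn3 : (3 : ℝ) ≤ n := by exact_mod_cast hn
  have hn0 : (n : ℝ) ≠ 0 := by linarith
  have hn1 : (n : ℝ) - 1 ≠ 0 := by linarith
  have hn2 : (n : ℝ) + 1 ≠ 0 := by linarith
  obtain ⟨s, hs⟩ : ∃ s : ℝ, s = n - (q + 2) := ⟨_, rfl⟩
  obtain ⟨a, ha⟩ : ∃ a : ℝ, a = s * (s + 1) / (6 * n) * ((s - 1) / (n - 1) - (s + 2) / (n + 1)) :=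
    ⟨_, rfl⟩
  obtain ⟨b, hb⟩ : ∃ b : ℝ, b = -((s + 1) * s * (s - 1)) / (6 * n * (n - 1)) - a * n := ⟨_, rfl⟩
  set V := cubicGreen a b (q + 2) with hV
  have hV0 : V 0 = 0 := by simp [hV, cubicGreen]
  have hV1 : V 1 = 0 := by simp [hV, cubicGreen]
  have hVn : V n = 0 := by
    simp only [hV, cubicGreen]
    rw [if_pos (by omega), hb, hs]
    push_cast
    field_simp
    ring
  have hVn' : V (n + 1) = 0 := by
    simp only [hV, cubicGreen]
    rw [if_pos (by omega), hb, ha, hs]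
    push_cast
    field_simp
    ring
  have hw : Delta n 2 *ᵥ ((Delta n 2)ᵀ *ᵥ fun r => V (r + 2)) =
      Pi.single (⟨q + 3 - 3, by omega⟩ : Fin (n - 2)) 1 := by
    rw [funext (Delta_two_transpose_mulVec n V hV0 hV1 hVn hVn')]
    ext r
    rw [Delta_two_mulVec n (fun c => V (c + 2) - 2 * V (c + 1) + V c)]
    refine (fourth_difference_cubicGreen a b (q + 2) r).trans ?_
    simp [Pi.single_apply, Fin.ext_iff]
  rw [sum_DeltaPinv_sq n 2 hinv _ _ hw]
  simp only [Nat.add_sub_cancel, hV, cubicGreen]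
  rw [if_pos le_rfl, hb, ha, hs]
  push_cast
  field_simp
  ring
end

section
/- Let n, k be integers with 1 ≤ k ≤ n−1, let S = {t₁,…,t_s} ⊆ {k+1,…,n} with k+1 ≤ t₁ < … < t_s ≤ n and t_s + k − 1 ≤ n, set t₀ := k, t_{s+1} := n+1, n_i := t_i − t_{i−1} for i ∈ {1,…,s+1}, n_max := max_{1≤i≤s+1} n_i, and assume s + k < n. Let f⁰ ∈ ℝ^n, let ε ∈ ℝ^n have n i.i.d. standard Gaussian N(0,1) coordinates, and Y := f⁰ + ε. Let u > 0, v > 0 and let λ > 0 satisfy λ ≥ n^{k−1}·(n_max/(2n))^{(2k−1)/2}·√((2·log(2(n−s−k)) + 2u)/n). Then for every f ∈ ℝ^n, with probability at least 1 − e^{−u} − e^{−v} (with respect to the law of ε), every minimizer f̂ of g ↦ ‖Y − g‖_n² + 2λ‖Δ(k)g‖₁ satisfies ‖f̂ − f⁰‖_n² ≤ ‖f − f⁰‖_n² + 4λ‖Δ(k)f‖₁ + (√(k(s+1)/n) + √(2v/n))². -/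
open MeasureTheory ProbabilityTheory Finset Matrix

section StandardGaussian

open scoped InnerProductSpace

variable {E : Type*} [NormedAddCommGroup E] [InnerProductSpace ℝ E] [FiniteDimensional ℝ E]
  [MeasurableSpace E] [BorelSpace E]

lemma stdGaussian_map_orthogonalProjection (N : Submodule ℝ E) :
    (stdGaussian E).map N.orthogonalProjectionOnto = stdGaussian N := by
  apply Measure.ext_of_charFun
  ext y
  rw [charFun_stdGaussian, charFun_apply, integral_map (by fun_prop) (by fun_prop)]
  have h (x : E) : ⟪N.orthogonalProjectionOnto x, y⟫_ℝ = ⟪x, (y : E)⟫_ℝ := by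
    simp
  simp_rw [h, ← charFun_apply, charFun_stdGaussian]
  simp

lemma integral_exp_mul_sq_gaussianReal_s7 {θ : ℝ} (hθ : θ < 1 / 2) :
    Integrable (fun x => Real.exp (θ * x ^ 2)) (gaussianReal 0 1) ∧
      ∫ x, Real.exp (θ * x ^ 2) ∂(gaussianReal 0 1) = (1 - 2 * θ) ^ (-(1 / 2) : ℝ) := by
  have hb : 0 < 1 / 2 - θ := by linarith
  have hfun (x : ℝ) : gaussianPDFReal 0 1 x * Real.exp (θ * x ^ 2) =
      (Real.sqrt (2 * Real.pi))⁻¹ * Real.exp (-(1 / 2 - θ) * x ^ 2) := by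
    rw [gaussianPDFReal, mul_assoc, ← Real.exp_add]
    congr 2
    · norm_num
    · norm_num
      ring
  constructor
  · rw [gaussianReal_of_var_ne_zero _ one_ne_zero]
    rw [integrable_withDensity_iff_integrable_smul' (by fun_prop) (by simp [gaussianPDF])]
    simp only [gaussianPDF, smul_eq_mul,
      ENNReal.toReal_ofReal (gaussianPDFReal_nonneg _ _ _), hfun]
    exact (integrable_exp_neg_mul_sq hb).const_mul _
  · rw [integral_gaussianReal_eq_integral_smul one_ne_zero]
    simp only [smul_eq_mul, hfun]
    rw [integral_const_mul, integral_gaussian, Real.rpow_neg (by linarith), ← Real.sqrt_eq_rpow,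
      ← Real.sqrt_inv, ← Real.sqrt_inv, ← Real.sqrt_mul (by positivity)]
    congr 1
    field_simp

lemma integral_exp_mul_norm_sq_stdGaussian {θ : ℝ} (hθ : θ < 1 / 2) :
    Integrable (fun x : E => Real.exp (θ * ‖x‖ ^ 2)) (stdGaussian E) ∧
      ∫ x : E, Real.exp (θ * ‖x‖ ^ 2) ∂(stdGaussian E) =
        (1 - 2 * θ) ^ (-(Module.finrank ℝ E / 2) : ℝ) := by
  have hnorm (x : Fin (Module.finrank ℝ E) → ℝ) :
      Real.exp (θ * ‖∑ i, x i • stdOrthonormalBasis ℝ E i‖ ^ 2) =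
        ∏ i, Real.exp (θ * x i ^ 2) := by
    rw [← real_inner_self_eq_norm_sq, (stdOrthonormalBasis ℝ E).orthonormal.inner_sum,
      Finset.mul_sum, Real.exp_sum]
    simp [sq]
  constructor
  · rw [stdGaussian, integrable_map_measure (by fun_prop)
      (Measurable.aemeasurable (by fun_prop))]
    simp only [Function.comp_def, hnorm]
    exact Integrable.fintype_prod (f := fun _ x => Real.exp (θ * x ^ 2))
      fun _ => (integral_exp_mul_sq_gaussianReal_s7 hθ).1
  · rw [stdGaussian, integral_map (Measurable.aemeasurable (by fun_prop)) (by fun_prop)]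
    simp only [hnorm]
    rw [integral_fintype_prod_eq_prod (f := fun _ x => Real.exp (θ * x ^ 2))]
    simp only [(integral_exp_mul_sq_gaussianReal_s7 hθ).2, Finset.prod_const, Finset.card_univ,
      Fintype.card_fin]
    rw [← Real.rpow_natCast, ← Real.rpow_mul (by linarith)]
    congr 1
    ring

lemma stdGaussian_norm_ge_le {d v : ℝ} (hd : 0 < d) (hdim : Module.finrank ℝ E ≤ d)
    (hv : 0 < v) :
    (stdGaussian E).real {x | Real.sqrt d + Real.sqrt (2 * v) ≤ ‖x‖} ≤ Real.exp (-v) := by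
  set p := Real.sqrt d
  set a := Real.sqrt (2 * v)
  have hp : 0 < p := Real.sqrt_pos.2 hd
  have ha : 0 < a := Real.sqrt_pos.2 (by linarith)
  have hpd : p ^ 2 = d := Real.sq_sqrt hd.le
  have hav : a ^ 2 = 2 * v := Real.sq_sqrt (by linarith)
  set q := d / (p + a) ^ 2
  have hq : 0 < q := by positivity
  have hq1 : q ≤ 1 := by
    rw [div_le_one (by positivity)]
    nlinarith
  set θ := (1 - q) / 2
  have hθ : θ < 1 / 2 := by simp only [θ]; linarith
  have h1 : 1 - 2 * θ = q := by simp only [θ]; ring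
  obtain ⟨hint, hval⟩ := integral_exp_mul_norm_sq_stdGaussian (E := E) hθ
  have hch := measure_ge_le_exp_mul_mgf (μ := stdGaussian E) (X := fun x : E => ‖x‖ ^ 2)
    ((p + a) ^ 2) (t := θ) (by simp only [θ]; linarith) hint
  rw [mgf, hval, h1] at hch
  have hset : {x : E | p + a ≤ ‖x‖} = {x : E | (p + a) ^ 2 ≤ ‖x‖ ^ 2} := by
    ext x
    exact (pow_le_pow_iff_left₀ (by positivity) (norm_nonneg x) two_ne_zero).symm
  rw [hset]
  refine hch.trans ?_
  rw [Real.rpow_def_of_pos hq, ← Real.exp_add]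
  apply Real.exp_le_exp.2
  have hlog : Real.log q = -(2 * Real.log (1 + a / p)) := by
    have : q = ((1 + a / p) ^ 2)⁻¹ := by
      simp only [q]
      rw [← hpd]
      field_simp
    rw [this, Real.log_inv, Real.log_pow]
    norm_num
  have hlog1 : Real.log (1 + a / p) ≤ a / p := by
    have := Real.log_le_sub_one_of_pos (show 0 < 1 + a / p by positivity)
    linarith
  have hlog0 : 0 ≤ Real.log (1 + a / p) := Real.log_nonneg (by
    have : 0 < a / p := by positivity
    linarith)
  have h2 : θ * (p + a) ^ 2 = p * a + v := by
    have : q * (p + a) ^ 2 = d := by simp only [q]; field_simp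
    simp only [θ]
    linear_combination (-1 / 2) * this + (1 / 2) * hpd + (1 / 2) * hav
  have h3 : (Module.finrank ℝ E : ℝ) * Real.log (1 + a / p) ≤ p * a := by
    calc _ ≤ d * (a / p) := by gcongr
      _ = p * a := by rw [← hpd]; field_simp
  rw [hlog]
  linarith

lemma stdGaussian_abs_inner_ge_le {w : E} {σ x : ℝ} (hσ : 0 < σ) (hw : ‖w‖ ≤ σ) (hx : 0 ≤ x) :
    (stdGaussian E).real {y | σ * x ≤ |⟪w, y⟫_ℝ|} ≤ 2 * Real.exp (-x ^ 2 / 2) := by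
  have key (w : E) (hw : ‖w‖ ≤ σ) :
      (stdGaussian E).real {y | σ * x ≤ ⟪w, y⟫_ℝ} ≤ Real.exp (-x ^ 2 / 2) := by
    have hmap : (stdGaussian E).map (fun y => ⟪w, y⟫_ℝ) = gaussianReal 0 (‖w‖₊ ^ 2) := by
      have := IsGaussian.map_eq_gaussianReal (μ := stdGaussian E) (innerSL ℝ w)
      rw [integral_strongDual_stdGaussian, variance_dual_stdGaussian, innerSL_apply_norm] at this
      rw [← coe_nnnorm, ← NNReal.coe_pow, Real.toNNReal_coe] at this
      exact this
    have hsub : HasSubgaussianMGF (fun y => ⟪w, y⟫_ℝ) (σ.toNNReal ^ 2) (stdGaussian E) := by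
      constructor
      · intro t
        have : IsGaussian (gaussianReal 0 (‖w‖₊ ^ 2)) := inferInstance
        have h := integrable_exp_mul_gaussianReal (μ := 0) (v := ‖w‖₊ ^ 2) t
        rw [← hmap, integrable_map_measure (by fun_prop) (by fun_prop)] at h
        exact h
      · intro t
        rw [mgf_gaussianReal hmap]
        apply Real.exp_le_exp.2
        simp only [NNReal.coe_pow, coe_nnnorm, Real.coe_toNNReal σ hσ.le, zero_mul, zero_add]
        gcongr
    refine (hsub.measure_ge_le (by positivity)).trans (Real.exp_le_exp.2 (le_of_eq ?_))
    simp only [NNReal.coe_pow, Real.coe_toNNReal σ hσ.le]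
    field_simp
  calc (stdGaussian E).real {y | σ * x ≤ |⟪w, y⟫_ℝ|}
      ≤ (stdGaussian E).real ({y | σ * x ≤ ⟪w, y⟫_ℝ} ∪ {y | σ * x ≤ ⟪-w, y⟫_ℝ}) := by
        refine measureReal_mono fun y hy => ?_
        simpa [le_abs] using hy
    _ ≤ _ := measureReal_union_le _ _
    _ ≤ 2 * Real.exp (-x ^ 2 / 2) := by
        linarith [key w hw, key (-w) (by simpa using hw)]

lemma stdGaussian_projection_and_inner_le (N : Submodule ℝ E) {ι : Type*} [Fintype ι]
    (w : ι → E) {d σ m u v : ℝ} (hd : 0 < d) (hdim : Module.finrank ℝ N ≤ d) (hσ : 0 < σ)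
    (hw : ∀ i, ‖w i‖ ≤ σ) (hm : 1 ≤ m) (hcard : Fintype.card ι ≤ m) (hu : 0 < u) (hv : 0 < v) :
    ENNReal.ofReal (1 - Real.exp (-u) - Real.exp (-v)) ≤
      stdGaussian E {x | ‖N.orthogonalProjectionOnto x‖ ≤ Real.sqrt d + Real.sqrt (2 * v) ∧
        ∀ i, |⟪w i, x⟫_ℝ| ≤ σ * Real.sqrt (2 * Real.log (2 * m) + 2 * u)} := by
  set L := Real.sqrt (2 * Real.log (2 * m) + 2 * u)
  have hlog : 0 ≤ Real.log (2 * m) := Real.log_nonneg (by linarith)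
  have hL : L ^ 2 = 2 * Real.log (2 * m) + 2 * u := Real.sq_sqrt (by positivity)
  set A := {x : E | Real.sqrt d + Real.sqrt (2 * v) ≤ ‖N.orthogonalProjectionOnto x‖}
  set B := ⋃ i, {x : E | σ * L ≤ |⟪w i, x⟫_ℝ|}
  have hA : (stdGaussian E).real A ≤ Real.exp (-v) := by
    have h := stdGaussian_norm_ge_le (E := N) hd hdim hv
    rw [← stdGaussian_map_orthogonalProjection, map_measureReal_apply (by fun_prop)
      (measurableSet_le (by fun_prop) (by fun_prop))] at h
    exact h
  have hB : (stdGaussian E).real B ≤ Real.exp (-u) := by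
    calc _ ≤ ∑ i, (stdGaussian E).real {x : E | σ * L ≤ |⟪w i, x⟫_ℝ|} :=
          measureReal_iUnion_fintype_le _
      _ ≤ ∑ i : ι, 2 * Real.exp (-L ^ 2 / 2) :=
          Finset.sum_le_sum fun i _ => stdGaussian_abs_inner_ge_le hσ (hw i) (Real.sqrt_nonneg _)
      _ = Fintype.card ι * (2 * Real.exp (-L ^ 2 / 2)) := by simp
      _ ≤ m * (2 * Real.exp (-L ^ 2 / 2)) := by gcongr
      _ = Real.exp (-u) := by
          have : -L ^ 2 / 2 = -u - Real.log (2 * m) := by rw [hL]; ring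
          rw [this, Real.exp_sub, Real.exp_log (by linarith)]
          field_simp
  have hAm : MeasurableSet A := measurableSet_le (by fun_prop) (by fun_prop)
  have hBm : MeasurableSet B :=
    MeasurableSet.iUnion fun i => measurableSet_le (by fun_prop) (by fun_prop)
  calc _ ≤ ENNReal.ofReal ((stdGaussian E).real (A ∪ B)ᶜ) := by
        apply ENNReal.ofReal_le_ofReal
        rw [probReal_compl_eq_one_sub (hAm.union hBm)]
        linarith [measureReal_union_le (μ := stdGaussian E) A B]
    _ = stdGaussian E (A ∪ B)ᶜ := by simp
    _ ≤ _ := by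
        refine measure_mono fun x hx => ?_
        simp only [A, B, Set.mem_compl_iff, Set.mem_union, Set.mem_iUnion, Set.mem_ofPred_eq,
          not_or, not_exists, not_le] at hx
        exact ⟨hx.1.le, fun i => (hx.2 i).le⟩

end StandardGaussian

section PenalizedLeastSquares

open scoped InnerProductSpace

variable {E : Type*} [NormedAddCommGroup E] [InnerProductSpace ℝ E]

lemma inner_sub_le_of_forall_penalized_le
    {pen : E → ℝ} (hpen : ConvexOn ℝ Set.univ pen) {Y fhat f : E}
    (hmin : ∀ g, ‖Y - fhat‖ ^ 2 + 2 * pen fhat ≤ ‖Y - g‖ ^ 2 + 2 * pen g) :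
    ⟪Y - fhat, f - fhat⟫_ℝ ≤ pen f - pen fhat := by
  have key (η : ℝ) (h0 : 0 < η) (h1 : η < 1) :
      ⟪Y - fhat, f - fhat⟫_ℝ - (pen f - pen fhat) ≤ η * (‖f - fhat‖ ^ 2 / 2) := by
    have hm := hmin ((1 - η) • fhat + η • f)
    have hc := hpen.2 (Set.mem_univ fhat) (Set.mem_univ f) (sub_nonneg.2 h1.le) h0.le (by ring)
    have he : Y - ((1 - η) • fhat + η • f) = (Y - fhat) - η • (f - fhat) := by
      module
    rw [he, norm_sub_sq_real (Y - fhat) (η • _), inner_smul_right, norm_smul, mul_pow, Real.norm_eq_abs, sq_abs] at hm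
    simp only [smul_eq_mul] at hc
    refine le_of_mul_le_mul_left ?_ h0
    nlinarith
  have hlim : Filter.Tendsto (fun η : ℝ => η * (‖f - fhat‖ ^ 2 / 2)) (nhdsWithin 0 (Set.Ioi 0))
      (nhds 0) := by
    have : Filter.Tendsto (fun η : ℝ => η * (‖f - fhat‖ ^ 2 / 2)) (nhds 0)
      (nhds (0 * (‖f - fhat‖ ^ 2 / 2))) := (continuous_id.mul continuous_const).tendsto 0
    rw [zero_mul] at this
    exact this.mono_left nhdsWithin_le_nhds
  have := ge_of_tendsto hlim (b := ⟪Y - fhat, f - fhat⟫_ℝ - (pen f - pen fhat)) (by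
    filter_upwards [Ioo_mem_nhdsGT (zero_lt_one (α := ℝ))] with η hη using key η hη.1 hη.2)
  linarith

section RightInverse

variable [FiniteDimensional ℝ E] {ι : Type*} [Fintype ι] [DecidableEq ι] {D : E →ₗ[ℝ] (ι → ℝ)} {ψ : ι → E}

omit [FiniteDimensional ℝ E] in
lemma apply_sum_smul_eq_self (hψ : ∀ i, D (ψ i) = Pi.single i 1) (a : ι → ℝ) :
    D (∑ i, a i • ψ i) = a := by
  simp only [map_sum, map_smul, hψ]
  ext j
  simp [Pi.single_apply]

lemma finrank_ker_add_card (hψ : ∀ i, D (ψ i) = Pi.single i 1) :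
    Module.finrank ℝ (LinearMap.ker D) + Fintype.card ι = Module.finrank ℝ E := by
  have hs : Function.Surjective D := fun a => ⟨_, apply_sum_smul_eq_self hψ a⟩
  have := D.finrank_range_add_finrank_ker
  rw [LinearMap.range_eq_top.2 hs, finrank_top, Module.finrank_fintype_fun_eq_card] at this
  omega

lemma inner_eq_inner_projection_add_sum (hψ : ∀ i, D (ψ i) = Pi.single i 1) (x g : E) :
    ⟪x, g⟫_ℝ = ⟪(LinearMap.ker D).starProjection x, g⟫_ℝ +
      ∑ i, D g i * ⟪ψ i - (LinearMap.ker D).starProjection (ψ i), x⟫_ℝ := by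
  set N := LinearMap.ker D
  set h := ∑ i, D g i • ψ i
  have hmem : g - h ∈ N := by
    rw [LinearMap.mem_ker, map_sub, apply_sum_smul_eq_self hψ, sub_self]
  have h1 : N.starProjection (g - h) = g - h := Submodule.starProjection_eq_self_iff.2 hmem
  have h2 : g = N.starProjection g + ∑ i, D g i • (ψ i - N.starProjection (ψ i)) := by
    have : ∑ i, D g i • (ψ i - N.starProjection (ψ i)) = h - N.starProjection h := by
      simp [h, smul_sub, Finset.sum_sub_distrib]
    rw [this]
    rw [map_sub] at h1
    rw [← sub_eq_zero] at h1 ⊢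
    rw [← neg_eq_zero, ← h1]
    abel
  conv_lhs => rw [h2]
  rw [inner_add_right, inner_sum]
  congr 1
  · exact (N.inner_starProjection_left_eq_right x g).symm
  · refine Finset.sum_congr rfl fun i _ => ?_
    rw [inner_smul_right, real_inner_comm]

lemma norm_sub_sq_le_of_forall_penalized_le (hψ : ∀ i, D (ψ i) = Pi.single i 1)
    {pen : E → ℝ} (hpen : ConvexOn ℝ Set.univ pen) (hsub : ∀ a b, pen (a - b) ≤ pen a + pen b)
    {Λ ρ : ℝ} (hD : ∀ g, Λ * ∑ i, |D g i| ≤ pen g) {f0 ε fhat f : E}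
    (hproj : ‖(LinearMap.ker D).orthogonalProjectionOnto ε‖ ≤ ρ)
    (hnoise : ∀ i, |⟪ψ i - (LinearMap.ker D).starProjection (ψ i), ε⟫_ℝ| ≤ Λ)
    (hmin : ∀ g, ‖f0 + ε - fhat‖ ^ 2 + 2 * pen fhat ≤ ‖f0 + ε - g‖ ^ 2 + 2 * pen g) :
    ‖fhat - f0‖ ^ 2 ≤ ‖f - f0‖ ^ 2 + 4 * pen f + ρ ^ 2 := by
  have h1 := inner_sub_le_of_forall_penalized_le (f := f) hpen hmin
  have h2 := inner_eq_inner_projection_add_sum hψ ε (fhat - f)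
  have h3 : ⟪(LinearMap.ker D).starProjection ε, fhat - f⟫_ℝ ≤ ρ * ‖fhat - f‖ :=
    (real_inner_le_norm _ _).trans (mul_le_mul_of_nonneg_right hproj (norm_nonneg _))
  have h4 : ∑ i, D (fhat - f) i * ⟪ψ i - (LinearMap.ker D).starProjection (ψ i), ε⟫_ℝ ≤
      pen fhat + pen f := by
    refine le_trans ?_ ((hD _).trans (hsub _ _))
    rw [Finset.mul_sum]
    refine Finset.sum_le_sum fun i _ => (le_abs_self _).trans ?_
    rw [abs_mul, mul_comm]
    exact mul_le_mul_of_nonneg_right (hnoise i) (abs_nonneg _)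
  have h5 : ‖f - f0‖ ^ 2 = ‖fhat - f0‖ ^ 2 + 2 * ⟪f0 - fhat, fhat - f⟫_ℝ + ‖fhat - f‖ ^ 2 := by
    have : f - f0 = -(f0 - fhat) - (fhat - f) := by abel
    rw [this, norm_sub_sq_real, norm_neg, inner_neg_left, norm_sub_rev f0 fhat]
    ring
  have h6 : ⟪f0 + ε - fhat, f - fhat⟫_ℝ = -⟪f0 - fhat, fhat - f⟫_ℝ - ⟪ε, fhat - f⟫_ℝ := by
    rw [← neg_sub fhat f, inner_neg_right, show f0 + ε - fhat = (f0 - fhat) + ε by abel,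
      inner_add_left]
    ring
  nlinarith [sq_nonneg (ρ - ‖fhat - f‖)]

end RightInverse
end PenalizedLeastSquares

section DifferenceOperator

lemma fwdDiff_iter_congr {f g : ℕ → ℝ} {k y : ℕ} (h : ∀ c, y ≤ c → c ≤ y + k → f c = g c) :
    (fwdDiff 1)^[k] f y = (fwdDiff 1)^[k] g y := by
  simp only [fwdDiff_iter_eq_sum_shift]
  refine Finset.sum_congr rfl fun l hl => ?_
  rw [Finset.mem_range] at hl
  rw [smul_eq_mul, mul_one, h _ (by omega) (by omega)]

lemma fwdDiff_iter_eq_zero {f : ℕ → ℝ} {k y : ℕ} (h : ∀ c, y ≤ c → c ≤ y + k → f c = 0) :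
    (fwdDiff 1)^[k] f y = 0 := by
  rw [fwdDiff_iter_congr (g := fun _ => 0) h, fwdDiff_iter_eq_sum_shift]
  simp

lemma Delta_mulVec_apply (n k : ℕ) (f : ℕ → ℝ) (r : Fin (n - k)) :
    (Delta n k).mulVec (fun c => f c) r = (fwdDiff 1)^[k] f r := by
  have hr : (r : ℕ) + k < n := by omega
  rw [fwdDiff_iter_eq_sum_shift]
  simp only [Delta, Matrix.mulVec, dotProduct, Matrix.of_apply]
  rw [Fin.sum_univ_eq_sum_range (fun c => (if (r : ℕ) ≤ c ∧ c ≤ k + r then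
    (-1 : ℝ) ^ (k + (r : ℕ) - c) * (k.choose (k + (r : ℕ) - c) : ℝ) else 0) * f c) n]
  simp only [ite_mul, zero_mul]
  rw [← Finset.sum_filter, Finset.range_eq_Ico,
    show (Finset.Ico 0 n).filter (fun c => (r : ℕ) ≤ c ∧ c ≤ k + r) =
      Finset.Ico (r : ℕ) (r + (k + 1)) by ext; simp; omega,
    Finset.sum_Ico_eq_sum_range, Nat.add_sub_cancel_left]
  refine Finset.sum_congr rfl fun l hl => ?_
  rw [Finset.mem_range] at hl
  rw [show k + (r : ℕ) - (r + l) = k - l by omega, Nat.choose_symm (by omega)]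
  simp

/-- The truncated polynomial of degree `k` supported on `[r + k + 1, ∞)` whose difference of
order `k + 1` is the indicator of `r`. -/
def rightPower (k r c : ℕ) : ℝ :=
  if r + k + 1 ≤ c then ((c - r - 1).choose k : ℝ) else 0

/-- The truncated polynomial of degree `k` supported on `[0, r]` whose difference of
order `k + 1` is the indicator of `r`. -/
def leftPower (k r c : ℕ) : ℝ :=
  if c ≤ r then (-1) ^ (k + 1) * ((r + k - c).choose k : ℝ) else 0

lemma fwdDiff_iter_rightPower (k r : ℕ) :
    (fwdDiff 1)^[k + 1] (rightPower k r) = fun c => if c = r then 1 else 0 := by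
  induction k with
  | zero =>
    ext c
    simp only [zero_add, Function.iterate_one, fwdDiff, rightPower, Nat.choose_zero_right]
    split_ifs <;> first | omega | simp
  | succ k ih =>
    rw [Function.iterate_succ_apply, ← ih]
    congr 1
    ext c
    simp only [fwdDiff, rightPower]
    rcases lt_trichotomy c (r + k + 1) with h | rfl | h
    · rw [if_neg (by omega), if_neg (by omega), if_neg (by omega), sub_zero]
    · rw [if_pos (by omega), if_neg (by omega), if_pos (by omega)]
      rw [show r + k + 1 + 1 - r - 1 = k + 1 by omega, show r + k + 1 - r - 1 = k by omega]
      simp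
    · obtain ⟨d, rfl⟩ := Nat.exists_eq_add_of_lt h
      rw [if_pos (by omega), if_pos (by omega), if_pos (by omega),
        show r + k + 1 + d + 1 + 1 - r - 1 = (k + d + 1) + 1 by omega,
        show r + k + 1 + d + 1 - r - 1 = k + d + 1 by omega,
        Nat.choose_succ_succ (k + d + 1) k]
      push_cast
      ring

lemma fwdDiff_iter_leftPower (k r : ℕ) :
    (fwdDiff 1)^[k + 1] (leftPower k r) = fun c => if c = r then 1 else 0 := by
  induction k with
  | zero =>
    ext c
    simp only [zero_add, Function.iterate_one, fwdDiff, leftPower, Nat.choose_zero_right]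
    split_ifs <;> first | omega | simp
  | succ k ih =>
    rw [Function.iterate_succ_apply, ← ih]
    congr 1
    ext c
    simp only [fwdDiff, leftPower]
    rcases lt_trichotomy c r with h | rfl | h
    · obtain ⟨d, rfl⟩ := Nat.exists_eq_add_of_lt h
      rw [if_pos (by omega), if_pos (by omega), if_pos (by omega),
        show c + d + 1 + (k + 1) - (c + 1) = d + k + 1 by omega,
        show c + d + 1 + (k + 1) - c = (d + k + 1) + 1 by omega,
        show c + d + 1 + k - c = d + k + 1 by omega, Nat.choose_succ_succ (d + k + 1) k]
      push_cast
      ring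
    · rw [if_neg (by omega), if_pos (by omega), if_pos (by omega)]
      simp
      ring
    · rw [if_neg (by omega), if_neg (by omega), if_neg (by omega), sub_zero]

lemma choose_add_self_le_pow (m k : ℕ) : (m + k).choose k ≤ (m + 1) ^ k := by
  induction k with
  | zero => simp
  | succ k ih =>
    have h := Nat.add_one_mul_choose_eq (m + k) k
    refine Nat.le_of_mul_le_mul_right ?_ (Nat.succ_pos k)
    rw [Nat.succ_eq_add_one, ← add_assoc, ← h, pow_succ]
    calc (m + k + 1) * (m + k).choose k ≤ ((m + 1) * (k + 1)) * (m + 1) ^ k :=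
          Nat.mul_le_mul (by nlinarith) ih
      _ = _ := by ring

lemma sum_sq_le_of_support {ψ : ℕ → ℝ} {n a b m k : ℕ} (hab : b - a ≤ m)
    (hsupp : ∀ c, ¬(a ≤ c ∧ c < b) → ψ c = 0) (hψ : ∀ c, a ≤ c → c < b → |ψ c| ≤ (m : ℝ) ^ k) :
    ∑ c ∈ Finset.range n, ψ c ^ 2 ≤ (m : ℝ) ^ (2 * k + 1) := by
  calc ∑ c ∈ Finset.range n, ψ c ^ 2 ≤ ∑ c ∈ Finset.Ico a b, ((m : ℝ) ^ k) ^ 2 := by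
        rw [← Finset.sum_filter_of_ne (p := fun c => a ≤ c ∧ c < b)]
        · refine (Finset.sum_le_sum fun c hc => ?_).trans
            (Finset.sum_le_sum_of_subset_of_nonneg (t := Finset.Ico a b) ?_ ?_)
          · rw [Finset.mem_filter] at hc
            exact sq_le_sq' (abs_le.1 (hψ c hc.2.1 hc.2.2)).1 (abs_le.1 (hψ c hc.2.1 hc.2.2)).2
          · intro c hc
            simp only [Finset.mem_filter, Finset.mem_Ico] at hc ⊢
            exact hc.2
          · intros
            positivity
        · intro c _ hc
          by_contra h
          exact hc (by rw [hsupp c h]; simp)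
    _ = ((b - a : ℕ) : ℝ) * ((m : ℝ) ^ k) ^ 2 := by simp
    _ ≤ (m : ℝ) * ((m : ℝ) ^ k) ^ 2 := by gcongr
    _ = _ := by ring

lemma exists_block_fwdDiff_dual {k A B r : ℕ} (n : ℕ) (hA : A ≤ r) (hB : r + k + 1 < B) :
    ∃ ψ : ℕ → ℝ, (∀ r', A ≤ r' → r' + k + 1 < B →
        (fwdDiff 1)^[k + 1] ψ r' = if r' = r then 1 else 0) ∧
      (∀ r', r' + k + 1 < A ∨ B ≤ r' → (fwdDiff 1)^[k + 1] ψ r' = 0) ∧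
      ∑ c ∈ Finset.range n, ψ c ^ 2 ≤ (((B - A - k : ℕ) : ℝ) / 2) ^ (2 * k + 1) := by
  have hdual (P : ℕ → ℝ)
      (hP : (fwdDiff 1)^[k + 1] P = fun c => if c = r then 1 else 0) :
      (∀ r', A ≤ r' → r' + k + 1 < B →
        (fwdDiff 1)^[k + 1] (fun c => if A ≤ c ∧ c < B then P c else 0) r' =
          if r' = r then 1 else 0) ∧
      (∀ r', r' + k + 1 < A ∨ B ≤ r' →
        (fwdDiff 1)^[k + 1] (fun c => if A ≤ c ∧ c < B then P c else 0) r' = 0) := by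
    refine ⟨fun r' h1 h2 => ?_, fun r' h => fwdDiff_iter_eq_zero fun c h1 h2 => ?_⟩
    · rw [← congrFun hP r']
      exact fwdDiff_iter_congr fun c h3 h4 => if_pos ⟨by omega, by omega⟩
    · exact if_neg (by omega)
  rcases le_total (B - r - k - 1) (r + 1 - A) with h | h
  · obtain ⟨h1, h2⟩ := hdual _ (fwdDiff_iter_rightPower k r)
    refine ⟨_, h1, h2, (sum_sq_le_of_support (a := r + k + 1) (b := B) (m := B - r - k - 1) (k := k)
      (by omega) ?_ ?_).trans ?_⟩
    · intro c hc
      simp only [rightPower]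
      split_ifs <;> first | rfl | omega
    · intro c hc1 hc2
      simp only [rightPower]
      rw [if_pos (by omega), if_pos hc1, Nat.abs_cast]
      obtain ⟨d, rfl⟩ := Nat.exists_eq_add_of_le hc1
      rw [show r + k + 1 + d - r - 1 = d + k by omega]
      exact_mod_cast (choose_add_self_le_pow d k).trans (Nat.pow_le_pow_left (by omega) k)
    · refine pow_le_pow_left₀ (by positivity) ?_ _
      rw [le_div_iff₀ two_pos]
      exact_mod_cast (by omega : (B - r - k - 1) * 2 ≤ B - A - k)
  · obtain ⟨h1, h2⟩ := hdual _ (fwdDiff_iter_leftPower k r)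
    refine ⟨_, h1, h2, (sum_sq_le_of_support (a := A) (b := r + 1) (m := r + 1 - A) (k := k)
      (by omega) ?_ ?_).trans ?_⟩
    · intro c hc
      simp only [leftPower]
      split_ifs <;> first | rfl | omega
    · intro c hc1 hc2
      simp only [leftPower]
      rw [if_pos (by omega), if_pos (by omega), abs_mul, abs_pow, abs_neg, abs_one, one_pow,
        one_mul, Nat.abs_cast]
      rw [show r + k - c = (r - c) + k by omega]
      exact_mod_cast (choose_add_self_le_pow (r - c) k).trans (Nat.pow_le_pow_left (by omega) k)
    · refine pow_le_pow_left₀ (by positivity) ?_ _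
      rw [le_div_iff₀ two_pos]
      exact_mod_cast (by omega : (r + 1 - A) * 2 ≤ B - A - k)

lemma exists_le_and_lt_succ {t : ℕ → ℕ} {s x : ℕ} (h0 : t 0 ≤ x) (h1 : x < t (s + 1)) :
    ∃ i ≤ s, t i ≤ x ∧ x < t (i + 1) := by
  induction s with
  | zero => exact ⟨0, le_rfl, h0, h1⟩
  | succ s ih =>
    by_cases h : x < t (s + 1)
    · obtain ⟨i, hi, h2⟩ := ih h
      exact ⟨i, by omega, h2⟩
    · exact ⟨s + 1, le_rfl, by omega, h1⟩

open scoped Classical in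
/-- The rows of `Delta n k` that do not meet the knots `t 1, …, t s`. -/
noncomputable def blockRows (n k s : ℕ) (t : ℕ → ℕ) : Finset (Fin (n - k)) :=
  Finset.univ.filter fun r : Fin (n - k) =>
    ∀ i ∈ Finset.Icc 1 s, (r : ℕ) + k + 1 < t i ∨ t i + k ≤ (r : ℕ) + k + 1

lemma mem_blockRows {n k s : ℕ} {t : ℕ → ℕ} {r : Fin (n - k)} : r ∈ blockRows n k s t ↔
    ∀ i ∈ Finset.Icc 1 s, (r : ℕ) + k + 1 < t i ∨ t i + k ≤ (r : ℕ) + k + 1 := by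
  simp [blockRows]

lemma le_card_blockRows (n k s : ℕ) (t : ℕ → ℕ) : n ≤ (blockRows n k s t).card + k * (s + 1) := by
  have hc : (blockRows n k s t)ᶜ.card ≤ s * k := by
    have hsub : (blockRows n k s t)ᶜ.image (fun r : Fin (n - k) => (r : ℕ) + k + 1) ⊆
        (Finset.Icc 1 s).biUnion fun i => Finset.Ico (t i) (t i + k) := by
      intro x hx
      simp only [mem_blockRows, Finset.mem_image, Finset.mem_compl, not_forall, not_or, not_lt, not_le] at hx
      obtain ⟨r, ⟨i, hi, h1, h2⟩, rfl⟩ := hx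
      exact Finset.mem_biUnion.2 ⟨i, hi, Finset.mem_Ico.2 ⟨h1, h2⟩⟩
    rw [← Finset.card_image_of_injective (f := fun r : Fin (n - k) => (r : ℕ) + k + 1) _
      (fun a b h => Fin.ext (by simpa using h))]
    refine (Finset.card_le_card hsub).trans ((Finset.card_biUnion_le).trans ?_)
    simp
  have := Finset.card_add_card_compl (blockRows n k s t)
  rw [Fintype.card_fin] at this
  rw [mul_add, mul_comm k s]
  omega

lemma knot_strictMonoOn {s : ℕ} {t : ℕ → ℕ} (ht : ∀ i ≤ s, t i < t (i + 1)) :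
    ∀ i j, i < j → j ≤ s + 1 → t i < t j := by
  intro i j hij hj
  induction j, hij using Nat.le_induction with
  | base => exact ht i (by omega)
  | succ j hij ih => exact (ih (by omega)).trans (ht j (by omega))

lemma card_blockRows_le {n k s : ℕ} {t : ℕ → ℕ} (hk : 1 ≤ k) (ht0 : t 0 = k)
    (hts : t (s + 1) = n + 1) (ht : ∀ i ≤ s, t i < t (i + 1)) :
    (blockRows n k s t).card + s + k ≤ n := by
  have hmono := knot_strictMonoOn ht
  have hcard : s ≤ (blockRows n k s t)ᶜ.card := by
    have hsub : (Finset.Icc 1 s).image t ⊆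
        (blockRows n k s t)ᶜ.image (fun r : Fin (n - k) => (r : ℕ) + k + 1) := by
      intro x hx
      obtain ⟨i, hi, rfl⟩ := Finset.mem_image.1 hx
      have hi' := Finset.mem_Icc.1 hi
      have h1 := hmono 0 i (by omega) (by omega)
      have h2 := hmono i (s + 1) (by omega) le_rfl
      refine Finset.mem_image.2 ⟨⟨t i - k - 1, by omega⟩, ?_, by simp; omega⟩
      simp only [mem_blockRows, Finset.mem_compl, not_forall]
      exact ⟨i, hi, by omega⟩
    have h := (Finset.card_le_card hsub).trans Finset.card_image_le
    rwa [Finset.card_image_of_injOn, Nat.card_Icc, Nat.add_sub_cancel] at h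
    intro i hi j hj hij
    simp only [Finset.coe_Icc, Set.mem_Icc] at hi hj
    by_contra hne
    rcases Nat.lt_or_gt_of_ne hne with h | h
    · exact (hmono i j h (by omega)).ne hij
    · exact (hmono j i h (by omega)).ne' hij
  have := Finset.card_add_card_compl (blockRows n k s t)
  rw [Fintype.card_fin] at this
  have := hmono 0 (s + 1) (by omega) le_rfl
  omega

lemma exists_dual_of_mem_blockRows {n k s nmax : ℕ} {t : ℕ → ℕ} (hk : 1 ≤ k) (ht0 : t 0 = k)
    (hts : t (s + 1) = n + 1) (hmax : ∀ i ≤ s, t (i + 1) - t i ≤ nmax) {r : Fin (n - k)}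
    (hr : r ∈ blockRows n k s t) :
    ∃ ψ : Fin n → ℝ, (∀ r' ∈ blockRows n k s t,
        (Delta n k).mulVec ψ r' = if r' = r then 1 else 0) ∧
      ∑ c, ψ c ^ 2 ≤ ((nmax : ℝ) / 2) ^ (2 * k - 1) := by
  obtain ⟨k, rfl⟩ := Nat.exists_eq_add_of_le' hk
  have hrn : (r : ℕ) + (k + 1) < n := by omega
  obtain ⟨i, his, hi1, hi2⟩ := exists_le_and_lt_succ (t := t) (s := s)
    (x := r + (k + 1) + 1) (by omega) (by omega)
  have hrow {r' : Fin (n - (k + 1))} (hr' : r' ∈ blockRows n (k + 1) s t) (j : ℕ) (hj1 : 1 ≤ j)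
      (hjs : j ≤ s) : (r' : ℕ) + (k + 1) + 1 < t j ∨ t j + (k + 1) ≤ r' + (k + 1) + 1 :=
    mem_blockRows.1 hr' j (Finset.mem_Icc.2 ⟨hj1, hjs⟩)
  have hmaxi := hmax i his
  obtain ⟨A, hA, hlen, hout⟩ : ∃ A ≤ (r : ℕ), t (i + 1) - 1 - A - k ≤ nmax ∧
      ∀ r' ∈ blockRows n (k + 1) s t, (r' : ℕ) < A → (r' : ℕ) + k + 1 < A := by
    rcases Nat.eq_zero_or_pos i with rfl | hi
    · exact ⟨0, by omega, by omega, by omega⟩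
    · have := hrow hr i hi his
      refine ⟨t i - 1, by omega, by omega, fun r' hr' h => ?_⟩
      have := hrow hr' i hi his
      omega
  obtain ⟨ψ, h1, h2, h3⟩ := exists_block_fwdDiff_dual (k := k) (B := t (i + 1) - 1) n hA
    (by omega)
  refine ⟨fun c => ψ c, fun r' hr' => ?_, ?_⟩
  · rw [Delta_mulVec_apply]
    have hr'n : (r' : ℕ) + (k + 1) < n := by omega
    have hB : (r' : ℕ) + k + 1 < t (i + 1) - 1 ∨ t (i + 1) - 1 ≤ r' := by
      rcases his.lt_or_eq with h | rfl
      · have := hrow hr' (i + 1) (by omega) (by omega)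
        omega
      · omega
    by_cases hAr : A ≤ (r' : ℕ)
    · rcases hB with hB | hB
      · rw [h1 _ hAr hB]
        simp [Fin.ext_iff]
      · rw [h2 _ (Or.inr hB), if_neg]
        rintro rfl
        omega
    · rw [h2 _ (Or.inl (hout r' hr' (by omega))), if_neg]
      rintro rfl
      omega
  · rw [Fin.sum_univ_eq_sum_range (fun c => ψ c ^ 2)]
    refine h3.trans ?_
    rw [show 2 * (k + 1) - 1 = 2 * k + 1 by omega]
    gcongr

end DifferenceOperator

lemma convexOn_mul_sum_abs {E ι : Type*} [AddCommGroup E] [Module ℝ E] [Fintype ι]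
    (D : E →ₗ[ℝ] (ι → ℝ)) {Λ : ℝ} (hΛ : 0 ≤ Λ) :
    ConvexOn ℝ Set.univ fun g => Λ * ∑ i, |D g i| := by
  refine ⟨convex_univ, fun x _ y _ a b ha hb _ => ?_⟩
  simp only [map_add, map_smul, Pi.add_apply, Pi.smul_apply, smul_eq_mul]
  calc Λ * ∑ i, |a * D x i + b * D y i| ≤ Λ * ∑ i, (a * |D x i| + b * |D y i|) := by
        gcongr with i
        refine (abs_add_le _ _).trans (le_of_eq ?_)
        rw [abs_mul, abs_mul, abs_of_nonneg ha, abs_of_nonneg hb]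
    _ = _ := by
        rw [Finset.sum_add_distrib, ← Finset.mul_sum, ← Finset.mul_sum]
        ring

lemma mul_sum_abs_sub_le {E ι : Type*} [AddCommGroup E] [Module ℝ E] [Fintype ι]
    (D : E →ₗ[ℝ] (ι → ℝ)) {Λ : ℝ} (hΛ : 0 ≤ Λ) (a b : E) :
    Λ * ∑ i, |D (a - b) i| ≤ Λ * ∑ i, |D a i| + Λ * ∑ i, |D b i| := by
  rw [← mul_add, ← Finset.sum_add_distrib]
  gcongr with i
  rw [map_sub, Pi.sub_apply]
  exact abs_sub _ _

lemma rpow_mul_sqrt_le_of_scaled_le {x a L lam : ℝ} {k : ℕ} (hx : 0 < x) (ha : 0 ≤ a)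
    (hk : 1 ≤ k)
    (h : x ^ (k - 1) * (a / (2 * x)) ^ ((2 * (k : ℝ) - 1) / 2) * Real.sqrt (L / x) ≤ lam) :
    (a / 2) ^ ((2 * (k : ℝ) - 1) / 2) * Real.sqrt L ≤ x * lam := by
  have hpow : x ^ (k - 1) * x * (x ^ ((2 * (k : ℝ) - 1) / 2))⁻¹ * (Real.sqrt x)⁻¹ = 1 := by
    rw [← pow_succ, Nat.sub_add_cancel hk, ← Real.rpow_natCast, Real.sqrt_eq_rpow,
      ← Real.rpow_neg hx.le, ← Real.rpow_neg hx.le, ← Real.rpow_add hx, ← Real.rpow_add hx,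
      ← Real.rpow_zero x]
    congr 1
    ring
  have h' := mul_le_mul_of_nonneg_left h hx.le
  rw [← div_div, Real.div_rpow (by positivity) hx.le, Real.sqrt_div' _ hx.le] at h'
  refine le_trans (le_of_eq ?_) h'
  simp only [div_eq_mul_inv] at hpow ⊢
  linear_combination (-((a * 2⁻¹) ^ ((2 * (k : ℝ) - 1) * 2⁻¹) * Real.sqrt L)) * hpow

/-- Theorem 3.4, almost minimax rates for trend filtering:
with `S = {t₁,…,t_s} ⊆ {k+1,…,n}`, `t₀ = k`, `t_{s+1} = n+1`, `nᵢ = tᵢ - t_{i-1}`,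
`n_max = max_i nᵢ`, and `λ ≥ n^{k-1}(n_max/(2n))^{(2k-1)/2}√((2 log(2(n-s-k)) + 2u)/n)`,
with probability at least `1 - e^{-u} - e^{-v}` every minimizer `f̂` of
`g ↦ ‖Y - g‖ₙ² + 2λ‖Δ(k)g‖₁` satisfies
`‖f̂ - f⁰‖ₙ² ≤ ‖f - f⁰‖ₙ² + 4λ‖Δ(k)f‖₁ + (√(k(s+1)/n) + √(2v/n))²`. -/
theorem stmt_7
    (n k s : ℕ) (hk : 1 ≤ k) (hkn : k ≤ n - 1)
    (t : ℕ → ℕ) (ht0 : t 0 = k) (hts : t (s + 1) = n + 1)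
    (htmono : ∀ i ≤ s, t i < t (i + 1))
    (htk : t s + k - 1 ≤ n) (hsk : s + k < n)
    (nmax : ℕ) (hnmax : nmax = (Finset.Icc 1 (s + 1)).sup fun i => t i - t (i - 1))
    (f0 : Fin n → ℝ)
    (u v lam : ℝ) (hu : 0 < u) (hv : 0 < v) (hlam : 0 < lam)
    (hlam2 : (n : ℝ) ^ (k - 1) * ((nmax : ℝ) / (2 * n)) ^ ((2 * (k : ℝ) - 1) / 2) *
        Real.sqrt ((2 * Real.log (2 * ((n : ℝ) - s - k)) + 2 * u) / n) ≤ lam)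
    (f : Fin n → ℝ) :
    ENNReal.ofReal (1 - Real.exp (-u) - Real.exp (-v)) ≤
      (Measure.pi fun _ : Fin n => gaussianReal 0 1)
        {ε : Fin n → ℝ |
          ∀ fhat : Fin n → ℝ,
            (∀ g : Fin n → ℝ,
              (∑ i, (f0 i + ε i - fhat i) ^ 2) / n
                  + 2 * lam * ∑ r, |(Delta n k).mulVec fhat r| ≤
                (∑ i, (f0 i + ε i - g i) ^ 2) / n
                  + 2 * lam * ∑ r, |(Delta n k).mulVec g r|) →
            (∑ i, (fhat i - f0 i) ^ 2) / n ≤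
              (∑ i, (f i - f0 i) ^ 2) / n
                + 4 * lam * ∑ r, |(Delta n k).mulVec f r|
                + (Real.sqrt ((k : ℝ) * (s + 1) / n) + Real.sqrt (2 * v / n)) ^ 2} := by
  have hn : (0 : ℝ) < n := by exact_mod_cast (by omega : 0 < n)
  have hmax (i : ℕ) (hi : i ≤ s) : t (i + 1) - t i ≤ nmax := by
    rw [hnmax]
    exact Finset.le_sup (f := fun i => t i - t (i - 1)) (Finset.mem_Icc.2 ⟨by omega, by omega⟩)
  have hnmax0 : (0 : ℝ) < nmax := by
    have := hmax 0 (Nat.zero_le s)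
    have := htmono 0 (Nat.zero_le s)
    exact_mod_cast (by omega : 0 < nmax)
  let Δ : EuclideanSpace ℝ (Fin n) →ₗ[ℝ] (Fin (n - k) → ℝ) :=
    (Delta n k).mulVecLin ∘ₗ (WithLp.linearEquiv 2 ℝ (Fin n → ℝ)).toLinearMap
  let D : EuclideanSpace ℝ (Fin n) →ₗ[ℝ] (blockRows n k s t → ℝ) :=
    LinearMap.funLeft ℝ ℝ Subtype.val ∘ₗ Δ
  choose ψ hψ hψnorm using fun r : blockRows n k s t =>
    exists_dual_of_mem_blockRows hk ht0 hts hmax r.2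
  let Ψ (r : blockRows n k s t) : EuclideanSpace ℝ (Fin n) := WithLp.toLp 2 (ψ r)
  have hDΨ (r : blockRows n k s t) : D (Ψ r) = Pi.single r 1 := by
    ext r'
    have := hψ r r' r'.2
    simp only [Pi.single_apply, Subtype.ext_iff]
    exact this
  set σ := ((nmax : ℝ) / 2) ^ ((2 * (k : ℝ) - 1) / 2) with hσdef
  have hσ : 0 < σ := by positivity
  have hΨσ (r : blockRows n k s t) : ‖Ψ r‖ ≤ σ := by
    refine (sq_le_sq₀ (norm_nonneg _) hσ.le).1 ?_
    rw [EuclideanSpace.real_norm_sq_eq]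
    refine (hψnorm r).trans (le_of_eq ?_)
    rw [hσdef, ← Real.rpow_natCast, ← Real.rpow_natCast, ← Real.rpow_mul (by positivity)]
    congr 1
    rw [Nat.cast_sub (by omega)]
    push_cast
    ring
  have hw (r : blockRows n k s t) : ‖Ψ r - (LinearMap.ker D).starProjection (Ψ r)‖ ≤ σ := by
    refine le_trans ?_ (hΨσ r)
    rw [← Submodule.starProjection_orthogonal_val]
    exact Submodule.norm_starProjection_apply_le _ _
  have hdim : (Module.finrank ℝ (LinearMap.ker D) : ℝ) ≤ k * (s + 1) := by
    have h1 := finrank_ker_add_card hDΨ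
    have h2 := le_card_blockRows n k s t
    rw [Fintype.card_coe, finrank_euclideanSpace_fin] at h1
    exact_mod_cast (by omega : Module.finrank ℝ (LinearMap.ker D) ≤ k * (s + 1))
  have hcard : (Fintype.card (blockRows n k s t) : ℝ) ≤ (n : ℝ) - s - k := by
    have := card_blockRows_le hk ht0 hts htmono
    rw [Fintype.card_coe, le_sub_iff_add_le, le_sub_iff_add_le]
    exact_mod_cast (by omega : (blockRows n k s t).card + k + s ≤ n)
  have hm : (1 : ℝ) ≤ (n : ℝ) - s - k := by
    rw [le_sub_iff_add_le, le_sub_iff_add_le]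
    exact_mod_cast (by omega : 1 + k + s ≤ n)
  have hk0 : (0 : ℝ) < k := by exact_mod_cast hk
  have hprob := stdGaussian_projection_and_inner_le (LinearMap.ker D) _
    (d := k * (s + 1)) (by positivity) hdim hσ hw hm hcard hu hv
  refine hprob.trans ?_
  rw [← map_pi_eq_stdGaussian]
  rw [Measure.map_apply (by fun_prop) ?_]
  swap
  · simp only [Set.ofPred_and, Set.ofPred_forall]
    exact (measurableSet_le (by fun_prop) (by fun_prop)).inter
      (MeasurableSet.iInter fun i => measurableSet_le (by fun_prop) (by fun_prop))
  refine measure_mono fun ε hε fhat hmin => ?_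
  obtain ⟨hproj, hnoise⟩ := hε
  have hΛ := rpow_mul_sqrt_le_of_scaled_le hn hnmax0.le hk hlam2
  have hnlam : 0 ≤ n * lam := by positivity
  have hsq (a b : Fin n → ℝ) :
      ‖(WithLp.toLp 2 a : EuclideanSpace ℝ (Fin n)) - WithLp.toLp 2 b‖ ^ 2 =
        ∑ i, (a i - b i) ^ 2 := by
    rw [EuclideanSpace.real_norm_sq_eq]
    rfl
  have horacle := norm_sub_sq_le_of_forall_penalized_le hDΨ (convexOn_mul_sum_abs Δ hnlam)
    (mul_sum_abs_sub_le Δ hnlam) (Λ := n * lam) (f0 := WithLp.toLp 2 f0) (f := WithLp.toLp 2 f)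
    (fhat := WithLp.toLp 2 fhat) (fun g => ?_) hproj (fun i => (hnoise i).trans hΛ) (fun g => ?_)
  · rw [hsq, hsq] at horacle
    have hρ : (Real.sqrt ((k : ℝ) * (s + 1) / n) + Real.sqrt (2 * v / n)) ^ 2 =
        (Real.sqrt ((k : ℝ) * (s + 1)) + Real.sqrt (2 * v)) ^ 2 / n := by
      rw [Real.sqrt_div' _ hn.le, Real.sqrt_div' _ hn.le, ← add_div, div_pow, Real.sq_sqrt hn.le]
    rw [hρ, div_le_iff₀ hn, add_mul, add_mul, div_mul_cancel₀ _ hn.ne', div_mul_cancel₀ _ hn.ne']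
    refine horacle.trans (le_of_eq ?_)
    change _ + 4 * (n * lam * ∑ r, |(Delta n k).mulVec f r|) + _ = _
    ring
  · refine mul_le_mul_of_nonneg_left ?_ hnlam
    change ∑ r : blockRows n k s t, |Δ g r| ≤ _
    rw [Finset.sum_coe_sort (blockRows n k s t) fun r => |Δ g r|]
    exact Finset.sum_le_sum_of_subset_of_nonneg (Finset.subset_univ _) fun _ _ _ => abs_nonneg _
  · have h := mul_le_mul_of_nonneg_right (hmin g.ofLp) hn.le
    rw [add_mul, add_mul, div_mul_cancel₀ _ hn.ne', div_mul_cancel₀ _ hn.ne'] at h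
    have h1 := hsq (fun i => f0 i + ε i) fhat
    have h2 := hsq (fun i => f0 i + ε i) g.ofLp
    change ‖WithLp.toLp 2 (fun i => f0 i + ε i) - WithLp.toLp 2 fhat‖ ^ 2 +
        2 * (n * lam * ∑ r, |(Delta n k).mulVec fhat r|) ≤
      ‖WithLp.toLp 2 (fun i => f0 i + ε i) - WithLp.toLp 2 g.ofLp‖ ^ 2 +
        2 * (n * lam * ∑ r, |(Delta n k).mulVec g.ofLp r|)
    linarith
end

section
/- Fix an integer k ≥ 1. There exists a constant C > 0 depending only on k such that for every integer d ≥ 2k, the vector q with entries q_j := j^{(2k−1)/2} for j = k,…,d satisfies Σ_{j=2k}^{d} ( Σ_{l=0}^{k} (−1)^l·binom(k,l)·(j−l)^{(2k−1)/2} )² ≤ C²·(1 + log d), and indeed Σ_{j=k}^{d} ( Σ_{l=0}^{k} (−1)^l·binom(k,l)·(j−l)^{(2k−1)/2} )² ≤ C²·(1 + log d). -/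
open Finset

theorem HasDerivAt.fwdDiff_iter {f f' : ℝ → ℝ} (hf : ∀ x, 0 < x → HasDerivAt f (f' x) x) (k : ℕ) :
    ∀ x, 0 < x → HasDerivAt ((fwdDiff 1)^[k] f) ((fwdDiff 1)^[k] f' x) x := by
  induction k with
  | zero => simpa using hf
  | succ k ih =>
    intro x hx
    simp only [Function.iterate_succ_apply']
    exact ((ih (x + 1) (by positivity)).comp_add_const x 1).sub (ih x hx)

/-- The `k`-th difference of `x ↦ x ^ s` decays like its `k`-th derivative when `s ≤ k`. -/
theorem exists_abs_fwdDiff_iter_rpow_le (k : ℕ) : ∀ s : ℝ, s ≤ k →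
    ∃ C : ℝ, 0 ≤ C ∧ ∀ y : ℝ, 0 < y →
      |(fwdDiff 1)^[k] (fun x : ℝ ↦ x ^ s) y| ≤ C * y ^ (s - k) := by
  induction k with
  | zero =>
    refine fun s _ ↦ ⟨1, zero_le_one, fun y hy ↦ ?_⟩
    simp [abs_of_pos (Real.rpow_pos_of_pos hy s)]
  | succ k ih =>
    intro s hs
    push_cast at hs
    obtain ⟨C, hC, hbound⟩ := ih (s - 1) (by linarith)
    refine ⟨|s| * C, by positivity, fun y hy ↦ ?_⟩
    have hderiv : ∀ x : ℝ, 0 < x →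
        HasDerivAt ((fwdDiff 1)^[k] fun x : ℝ ↦ x ^ s)
          (s * (fwdDiff 1)^[k] (fun x : ℝ ↦ x ^ (s - 1)) x) x := by
      intro x hx
      have h := HasDerivAt.fwdDiff_iter (f' := s • fun x : ℝ ↦ x ^ (s - 1))
        (fun x hx ↦ Real.hasDerivAt_rpow_const (p := s) (Or.inl hx.ne')) k x hx
      rwa [fwdDiff_iter_const_smul] at h
    obtain ⟨ξ, hξ, heq⟩ := exists_hasDerivAt_eq_slope ((fwdDiff 1)^[k] fun x : ℝ ↦ x ^ s) _
      (lt_add_one y)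
      (fun x hx ↦ (hderiv x (hy.trans_le hx.1)).continuousAt.continuousWithinAt)
      (fun x hx ↦ hderiv x (hy.trans hx.1))
    rw [add_sub_cancel_left, div_one] at heq
    rw [Function.iterate_succ_apply', fwdDiff, ← heq, abs_mul, mul_assoc]
    gcongr
    refine (hbound ξ (hy.trans hξ.1)).trans ?_
    push_cast
    rw [sub_sub, add_comm (1 : ℝ)]
    gcongr ?_ * ?_
    exact Real.rpow_le_rpow_of_nonpos hy hξ.1.le (by linarith)

theorem sum_choose_mul_sub_eq_fwdDiff_iter (f : ℝ → ℝ) {k j : ℕ} (h : k ≤ j) :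
    ∑ l ∈ range (k + 1), (-1 : ℝ) ^ l * (k.choose l : ℝ) * f ((j - l : ℕ) : ℝ) =
      (fwdDiff 1)^[k] f ((j - k : ℕ) : ℝ) := by
  rw [fwdDiff_iter_eq_sum_shift, ← sum_range_reflect]
  refine sum_congr rfl fun l hl ↦ ?_
  have hl : l ≤ k := by simpa [Nat.lt_succ_iff] using hl
  have hidx : k + 1 - 1 - l = k - l := by omega
  have harg : j - (k - l) = j - k + l := by omega
  rw [hidx, harg, Nat.choose_symm hl]
  simp

theorem sum_Icc_inv_sub_le_one_add_log (k d : ℕ) :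
    ∑ j ∈ Icc (k + 1) d, (((j - k : ℕ) : ℝ))⁻¹ ≤ 1 + Real.log d := by
  have heq : ∑ j ∈ Icc (k + 1) d, (((j - k : ℕ) : ℝ))⁻¹ = (harmonic (d - k) : ℝ) := by
    rw [← Ico_add_one_right_eq_Icc, sum_Ico_eq_sum_range, harmonic]
    push_cast
    refine sum_congr rfl fun i _ ↦ ?_
    rw [show k + 1 + i - k = i + 1 by omega]
    push_cast
    rfl
  rw [heq]
  refine (harmonic_le_one_add_log _).trans ?_
  gcongr 1 + ?_
  rcases Nat.eq_zero_or_pos (d - k) with h0 | h0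
  · simpa [h0] using Real.log_natCast_nonneg d
  · exact Real.log_le_log (by exact_mod_cast h0) (by exact_mod_cast Nat.sub_le d k)

/-- Lemma 3.6: for `q_j = j^{(2k-1)/2}`, the squared `k`-th order
discrete derivatives summed over `j` are bounded by `C²(1 + log d)`, both summing
from `j = 2k` and from `j = k`. -/
theorem stmt_8 (k : ℕ) (hk : 1 ≤ k) :
    ∃ C : ℝ, 0 < C ∧ ∀ d : ℕ, 2 * k ≤ d →
      ((∑ j ∈ Finset.Icc (2 * k) d,
          (∑ l ∈ Finset.range (k + 1),
            (-1 : ℝ) ^ l * (k.choose l : ℝ) *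
              ((j - l : ℕ) : ℝ) ^ ((2 * (k : ℝ) - 1) / 2)) ^ 2)
        ≤ C ^ 2 * (1 + Real.log d)) ∧
      ((∑ j ∈ Finset.Icc k d,
          (∑ l ∈ Finset.range (k + 1),
            (-1 : ℝ) ^ l * (k.choose l : ℝ) *
              ((j - l : ℕ) : ℝ) ^ ((2 * (k : ℝ) - 1) / 2)) ^ 2)
        ≤ C ^ 2 * (1 + Real.log d)) := by
  obtain ⟨A, -, hA⟩ := exists_abs_fwdDiff_iter_rpow_le k ((2 * (k : ℝ) - 1) / 2) (by linarith)
  set D : ℕ → ℝ := fun j ↦ ∑ l ∈ Finset.range (k + 1),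
    (-1 : ℝ) ^ l * (k.choose l : ℝ) * ((j - l : ℕ) : ℝ) ^ ((2 * (k : ℝ) - 1) / 2)
  have hterm : ∀ j, k + 1 ≤ j → D j ^ 2 ≤ A ^ 2 * (((j - k : ℕ) : ℝ))⁻¹ := by
    intro j hj
    have hpos : (0 : ℝ) < ((j - k : ℕ) : ℝ) := by exact_mod_cast Nat.sub_pos_of_lt hj
    have h := hA _ hpos
    rw [← sum_choose_mul_sub_eq_fwdDiff_iter _ (by omega : k ≤ j)] at h
    refine (sq_le_sq' (abs_le.mp h).1 (abs_le.mp h).2).trans_eq ?_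
    rw [mul_pow, ← Real.rpow_natCast (_ ^ _) 2, ← Real.rpow_mul hpos.le, ← Real.rpow_neg_one]
    congr 2
    push_cast
    ring
  have hmain : ∀ d, 2 * k ≤ d →
      ∑ j ∈ Icc k d, D j ^ 2 ≤ (D k ^ 2 + A ^ 2 + 1) * (1 + Real.log d) := by
    intro d hd
    have hlog := Real.log_natCast_nonneg d
    rw [← add_sum_Ioc_eq_sum_Icc (by omega : k ≤ d), ← Icc_add_one_left_eq_Ioc]
    have hsum : ∑ j ∈ Icc (k + 1) d, D j ^ 2 ≤ A ^ 2 * (1 + Real.log d) :=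
      calc ∑ j ∈ Icc (k + 1) d, D j ^ 2
          ≤ ∑ j ∈ Icc (k + 1) d, A ^ 2 * (((j - k : ℕ) : ℝ))⁻¹ :=
            sum_le_sum fun j hj ↦ hterm j (mem_Icc.mp hj).1
        _ ≤ A ^ 2 * (1 + Real.log d) := by
            rw [← mul_sum]
            gcongr
            exact sum_Icc_inv_sub_le_one_add_log k d
    nlinarith [mul_nonneg (sq_nonneg (D k)) hlog]
  have hC : 0 < D k ^ 2 + A ^ 2 + 1 := by positivity
  refine ⟨√(D k ^ 2 + A ^ 2 + 1), Real.sqrt_pos.mpr hC, fun d hd ↦ ?_⟩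
  rw [Real.sq_sqrt hC.le]
  refine ⟨le_trans ?_ (hmain d hd), hmain d hd⟩
  exact sum_le_sum_of_subset_of_nonneg (Icc_subset_Icc_left (by omega)) fun _ _ _ ↦ sq_nonneg _
end

section
/- Let D ∈ ℝ^{m×n} with rows indexed by 𝒟, S ⊆ 𝒟 with |S| = s, and w_{-S} = {w_j}_{j∈𝒟∖S} weights with 0 ≤ w_j ≤ 1. Let f ∈ ℝ^n and let q_S ∈ {−1,+1}^s satisfy (q_S)_j = sign((Df)_j) for all j ∈ S with (Df)_j ≠ 0. Then for all f̃ ∈ ℝ^n, ‖(Df)_S‖₁ − ‖(Df̃)_S‖₁ − ‖(1−w_{-S})(D(f̃ − f))_{-S}‖₁ ≤ Γ(q_S, w_{-S})·‖f − f̃‖_n. -/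
open Finset

/-- The functional whose supremum over the unit sphere is the noisy effective sparsity. -/
def sparsityGap {n m : ℕ} (D : Matrix (Fin m) (Fin n) ℝ) (S : Finset (Fin m))
    (w q : Fin m → ℝ) (g : Fin n → ℝ) : ℝ :=
  (∑ j ∈ S, q j * D.mulVec g j) - ∑ j ∈ Sᶜ, (1 - w j) * |D.mulVec g j|

/-- The sparsity gap is positively homogeneous. -/
lemma sparsityGap_smul {n m : ℕ} (D : Matrix (Fin m) (Fin n) ℝ) (S : Finset (Fin m))
    (w q : Fin m → ℝ) (g : Fin n → ℝ) {c : ℝ} (hc : 0 ≤ c) :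
    sparsityGap D S w q (c • g) = c * sparsityGap D S w q g := by
  simp only [sparsityGap, Matrix.mulVec_smul, Pi.smul_apply, smul_eq_mul, abs_mul,
    abs_of_nonneg hc, mul_sub, Finset.mul_sum]
  congr 1 <;> exact Finset.sum_congr rfl fun j _ => by ring

/-- The sparsity gap is bounded above on the unit sphere of the normalized norm. -/
lemma bddAbove_sparsityGap {n m : ℕ} (D : Matrix (Fin m) (Fin n) ℝ) (S : Finset (Fin m))
    (w q : Fin m → ℝ) (hw : ∀ j, j ∉ S → w j ≤ 1) (hq : ∀ j ∈ S, |q j| ≤ 1) :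
    BddAbove {x : ℝ | ∃ g : Fin n → ℝ, (∑ i, g i ^ 2) / n = 1 ∧
      x = sparsityGap D S w q g} := by
  refine ⟨∑ j ∈ S, ∑ i, |D j i| * √(n : ℝ), ?_⟩
  rintro x ⟨g, hg, rfl⟩
  have hsum : ∑ i, g i ^ 2 = n := eq_of_div_eq_one hg
  have hgi (i : Fin n) : |g i| ≤ √(n : ℝ) := by
    refine Real.abs_le_sqrt ?_
    rw [← hsum]
    exact Finset.single_le_sum (f := fun i => g i ^ 2) (fun _ _ => sq_nonneg _)
      (Finset.mem_univ i)
  have hnonneg : 0 ≤ ∑ j ∈ Sᶜ, (1 - w j) * |D.mulVec g j| :=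
    Finset.sum_nonneg fun j hj =>
      mul_nonneg (sub_nonneg.2 (hw j (Finset.mem_compl.1 hj))) (abs_nonneg _)
  refine (sub_le_self _ hnonneg).trans (Finset.sum_le_sum fun j hj => ?_)
  calc q j * D.mulVec g j ≤ |q j| * |D.mulVec g j| := by
        rw [← abs_mul]
        exact le_abs_self _
    _ ≤ |D.mulVec g j| := mul_le_of_le_one_left (abs_nonneg _) (hq j hj)
    _ ≤ ∑ i, |D j i * g i| := by
        simp only [Matrix.mulVec, dotProduct]
        exact Finset.abs_sum_le_sum_abs _ _
    _ ≤ ∑ i, |D j i| * √(n : ℝ) := Finset.sum_le_sum fun i _ => by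
        rw [abs_mul]
        exact mul_le_mul_of_nonneg_left (hgi i) (abs_nonneg _)

/-- If `q` agrees with the sign of `a` when `a ≠ 0`, then `|a| - |b| ≤ q * (a - b)`. -/
lemma abs_sub_abs_le_sign_mul {a b q : ℝ} (hq : |q| ≤ 1) (ha : a ≠ 0 → q = Real.sign a) :
    |a| - |b| ≤ q * (a - b) := by
  have hqa : q * a = |a| := by
    rcases eq_or_ne a 0 with rfl | h
    · simp
    · rw [ha h]
      rcases h.lt_or_gt with h | h
      · rw [Real.sign_of_neg h, abs_of_neg h, neg_one_mul]
      · rw [Real.sign_of_pos h, abs_of_pos h, one_mul]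
  have hqb : q * b ≤ |b| := by
    refine (le_abs_self _).trans ?_
    rw [abs_mul]
    exact mul_le_of_le_one_left (abs_nonneg _) hq
  rw [mul_sub, hqa]
  linarith

/-- A positively homogeneous bound: the sparsity gap is at most its supremum over the unit
sphere times the normalized norm. -/
lemma sparsityGap_le {n m : ℕ} (D : Matrix (Fin m) (Fin n) ℝ) (S : Finset (Fin m))
    (w q : Fin m → ℝ) (hw : ∀ j, j ∉ S → w j ≤ 1) (hq : ∀ j ∈ S, |q j| ≤ 1)
    (h : Fin n → ℝ) :
    sparsityGap D S w q h ≤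
      sSup {x : ℝ | ∃ g : Fin n → ℝ, (∑ i, g i ^ 2) / n = 1 ∧ x = sparsityGap D S w q g} *
        √((∑ i, h i ^ 2) / n) := by
  have hsq : 0 ≤ ∑ i, h i ^ 2 := Finset.sum_nonneg fun _ _ => sq_nonneg _
  have hnn : 0 ≤ (∑ i, h i ^ 2) / (n : ℝ) := by positivity
  set r := √((∑ i, h i ^ 2) / n) with hr
  rcases eq_or_ne r 0 with h0 | h0
  · have hzero : h = 0 := by
      funext i
      have hn : (n : ℝ) ≠ 0 := Nat.cast_ne_zero.2 (Fin.pos i).ne'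
      have hs : ∑ i, h i ^ 2 = 0 :=
        (div_eq_zero_iff.1 ((Real.sqrt_eq_zero hnn).1 h0)).resolve_right hn
      have := (Finset.sum_eq_zero_iff_of_nonneg fun _ _ => sq_nonneg _).1 hs i
        (Finset.mem_univ i)
      exact pow_eq_zero_iff two_ne_zero |>.1 this
    rw [h0, mul_zero, hzero]
    simp [sparsityGap]
  · have hr0 : 0 ≤ r := Real.sqrt_nonneg _
    have hr2 : r ^ 2 = (∑ i, h i ^ 2) / n := Real.sq_sqrt hnn
    have hmem : sparsityGap D S w q (r⁻¹ • h) ≤ sSup {x : ℝ | ∃ g : Fin n → ℝ,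
        (∑ i, g i ^ 2) / n = 1 ∧ x = sparsityGap D S w q g} := by
      refine le_csSup (bddAbove_sparsityGap D S w q hw hq) ⟨_, ?_, rfl⟩
      simp only [Pi.smul_apply, smul_eq_mul, mul_pow, ← Finset.mul_sum]
      rw [mul_div_assoc, ← hr2, ← mul_pow, inv_mul_cancel₀ h0, one_pow]
    calc sparsityGap D S w q h = r * sparsityGap D S w q (r⁻¹ • h) := by
          rw [← sparsityGap_smul D S w q _ hr0, smul_inv_smul₀ h0]
      _ ≤ _ := by
          rw [mul_comm]
          exact mul_le_mul_of_nonneg_right hmem hr0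

/-- Lemma A.3, a bound using `Γ(q_S, w_{-S})`: for any `f̃`,
`‖(Df)_S‖₁ - ‖(Df̃)_S‖₁ - ‖(1-w_{-S})(D(f̃ - f))_{-S}‖₁ ≤ Γ(q_S, w_{-S})‖f - f̃‖ₙ`. -/
theorem stmt_14
    (n m : ℕ)
    (D : Matrix (Fin m) (Fin n) ℝ)
    (S : Finset (Fin m))
    (w : Fin m → ℝ)
    (hw : ∀ j, j ∉ S → 0 ≤ w j ∧ w j ≤ 1)
    (f : Fin n → ℝ)
    -- the sign vector `q_S ∈ {-1,+1}^s` with `q_j = sign((Df)_j)` whenever `(Df)_j ≠ 0`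
    (q : Fin m → ℝ)
    (hq1 : ∀ j ∈ S, q j = 1 ∨ q j = -1)
    (hq2 : ∀ j ∈ S, D.mulVec f j ≠ 0 → q j = Real.sign (D.mulVec f j))
    -- the noisy effective sparsity `Γ(q_S, w_{-S})`
    (Γ : ℝ)
    (hΓ : Γ = sSup {x : ℝ | ∃ g : Fin n → ℝ, (∑ i, g i ^ 2) / n = 1 ∧
      x = (∑ j ∈ S, q j * D.mulVec g j) - ∑ j ∈ Sᶜ, (1 - w j) * |D.mulVec g j|}) :
    ∀ ftilde : Fin n → ℝ,
      (∑ j ∈ S, |D.mulVec f j|) - (∑ j ∈ S, |D.mulVec ftilde j|)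
          - ∑ j ∈ Sᶜ, (1 - w j) * |D.mulVec (ftilde - f) j| ≤
        Γ * Real.sqrt ((∑ i, (f i - ftilde i) ^ 2) / n) := by
  intro ftilde
  have hq (j) (hj : j ∈ S) : |q j| ≤ 1 := by
    rcases hq1 j hj with h | h <;> simp [h]
  have hgap := sparsityGap_le D S w q (fun j hj => (hw j hj).2) hq (f - ftilde)
  simp only [sparsityGap, Pi.sub_apply, ← hΓ] at hgap
  refine le_trans ?_ hgap
  rw [← Finset.sum_sub_distrib, ← neg_sub f ftilde]
  simp only [Matrix.mulVec_neg, Pi.neg_apply, abs_neg]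
  refine sub_le_sub_right (Finset.sum_le_sum fun j hj => ?_) _
  rw [Matrix.mulVec_sub, Pi.sub_apply]
  exact abs_sub_abs_le_sign_mul (hq j hj) (hq2 j hj)
end

section
/- Let n, k be integers with 1 ≤ k ≤ n−1, assume Δ(k)·Δ(k)ᵀ is invertible, and let ψ_j^𝒟 denote the j-th column of the Moore–Penrose pseudoinverse Δ(k)⁺ = Δ(k)ᵀ(Δ(k)Δ(k)ᵀ)⁻¹ ∈ ℝ^{n×(n−k)}, for j ∈ 𝒟 = {k+1,…,n}. Then for all j ∈ 𝒟, ‖ψ_j^𝒟‖₂² = ‖ψ_{n+k+1−j}^𝒟‖₂². -/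
open Finset Matrix

/-- Reversing rows and columns multiplies the difference operator by `(-1)^k`. -/
theorem Delta_rev_rev (n k : ℕ) (r : Fin (n - k)) (c : Fin n) :
    Delta n k r.rev c.rev = (-1) ^ k * Delta n k r c := by
  have hr := r.isLt
  have hc := c.isLt
  simp only [Delta, of_apply, Fin.val_rev]
  by_cases h : (r : ℕ) ≤ c ∧ (c : ℕ) ≤ k + r
  · obtain ⟨l, hl⟩ : ∃ l, k + (r : ℕ) - c = l := ⟨_, rfl⟩
    have hlk : l ≤ k := by omega
    have hl' : k + (n - k - (r + 1)) - (n - (c + 1)) = k - l := by omega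
    rw [if_pos h, if_pos (by omega), hl, hl', Nat.choose_symm hlk, ← mul_assoc]
    congr 1
    obtain ⟨m, rfl⟩ := Nat.exists_eq_add_of_le hlk
    rw [Nat.add_sub_cancel_left, pow_add, mul_right_comm, ← mul_pow]
    simp
  · rw [if_neg h, if_neg (by omega), mul_zero]

theorem Delta_submatrix_rev (n k : ℕ) :
    (Delta n k).submatrix Fin.revPerm Fin.revPerm = (-1 : ℝ) ^ k • Delta n k := by
  ext r c
  simpa using Delta_rev_rev n k r c

theorem Delta_mul_transpose_submatrix_rev (n k : ℕ) :
    (Delta n k * (Delta n k)ᵀ).submatrix Fin.revPerm Fin.revPerm =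
      Delta n k * (Delta n k)ᵀ := by
  rw [← submatrix_mul_equiv _ _ _ Fin.revPerm _, ← transpose_submatrix, Delta_submatrix_rev,
    transpose_smul, Matrix.smul_mul, Matrix.mul_smul, smul_smul, ← mul_pow]
  simp

/-- Reversing rows and columns multiplies the pseudoinverse by `(-1)^k`. -/
theorem DeltaPinv_submatrix_rev (n k : ℕ) :
    (DeltaPinv n k).submatrix Fin.revPerm Fin.revPerm = (-1 : ℝ) ^ k • DeltaPinv n k := by
  rw [DeltaPinv, ← submatrix_mul_equiv _ _ _ Fin.revPerm _, ← transpose_submatrix,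
    Delta_submatrix_rev, ← inv_submatrix_equiv, Delta_mul_transpose_submatrix_rev,
    transpose_smul, smul_mul]

/-- Lemma B.1, symmetry of `‖ψ_j^𝒟‖₂`: for `j ∈ 𝒟 = {k+1,…,n}`,
`‖ψ_j^𝒟‖₂² = ‖ψ_{n+k+1-j}^𝒟‖₂²`.  Here the column of index `r : Fin (n-k)`
corresponds to `j = r + k + 1`, and `j' = n + k + 1 - j` corresponds to the column
index `n - k - 1 - r`. -/
theorem stmt_15
    (n k : ℕ) (hk : 1 ≤ k) (hkn : k < n)
    (hinv : IsUnit (Delta n k * (Delta n k)ᵀ).det) :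
    ∀ r : Fin (n - k),
      (∑ i, (DeltaPinv n k i r) ^ 2) =
        ∑ i, (DeltaPinv n k i ⟨n - k - 1 - (r : ℕ), by omega⟩) ^ 2 := by
  intro r
  rw [← Equiv.sum_comp Fin.revPerm]
  refine Finset.sum_congr rfl fun i _ => ?_
  have h := congrFun₂ (DeltaPinv_submatrix_rev n k) i r.rev
  simp only [submatrix_apply, Fin.revPerm_apply, Fin.rev_rev, Matrix.smul_apply, smul_eq_mul] at h
  have hr : r.rev = ⟨n - k - 1 - (r : ℕ), by omega⟩ := by
    ext
    simp only [Fin.val_rev]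
    omega
  rw [Fin.revPerm_apply, h, mul_pow, ← pow_mul, mul_comm k 2, pow_mul, hr]
  simp
end

section
/- Let n ≥ 2, assume Δ(1)·Δ(1)ᵀ is invertible, and let ψ_j^𝒟 denote the j-th column of the Moore–Penrose pseudoinverse Δ(1)⁺ = Δ(1)ᵀ(Δ(1)Δ(1)ᵀ)⁻¹ ∈ ℝ^{n×(n−1)}, for j ∈ {2,…,n}. Then the entries of Δ(1)⁺ are ψ_{i,j}^𝒟 = (j−1)/n if j ≤ i and ψ_{i,j}^𝒟 = −(n−j+1)/n if j > i (for i ∈ {1,…,n}, j ∈ {2,…,n}), and consequently ‖ψ_j^𝒟‖₂² = (j−1)(n−j+1)/n for all j ∈ {2,…,n}. -/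
open Finset Matrix

theorem Delta_one_mulVec {n : ℕ} (f : Fin n → ℝ) (r : Fin (n - 1)) :
    (Delta n 1 *ᵥ f) r = f ⟨r + 1, by omega⟩ - f ⟨r, by omega⟩ := by
  have hentry : ∀ c : Fin n, Delta n 1 r c * f c =
      (if c = ⟨r + 1, by omega⟩ then f c else 0) - (if c = ⟨r, by omega⟩ then f c else 0) := by
    intro c
    simp only [Delta, of_apply, Fin.ext_iff]
    rcases lt_trichotomy (c : ℕ) r with h | h | h
    · rw [if_neg (by omega), if_neg (by omega), if_neg (by omega)]
      simp
    · rw [if_pos (by omega), if_neg (by omega), if_pos h]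
      simp [h]
    · by_cases h' : (c : ℕ) = r + 1
      · rw [if_pos (by omega), if_pos h', if_neg (by omega)]
        simp [h', add_comm]
      · rw [if_neg (by omega), if_neg h', if_neg (by omega)]
        simp
  simp only [mulVec, dotProduct, hentry, sum_sub_distrib, sum_ite_eq', mem_univ, if_true]

theorem sum_fin_step (n k : ℕ) (hk : k ≤ n) (a b : ℝ) :
    (∑ i : Fin n, if k ≤ (i : ℕ) then a else b) = ((n : ℝ) - k) * a + k * b := by
  rw [Fin.sum_univ_eq_sum_range (fun i => if k ≤ i then a else b),
    ← sum_range_add_sum_Ico _ hk,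
    sum_congr rfl (fun i hi => if_neg (not_le.2 (mem_range.1 hi))),
    sum_congr rfl (fun i hi => if_pos (mem_Ico.1 hi).1)]
  simp [Nat.cast_sub hk, add_comm]

theorem eq_of_Delta_one_mulVec_eq {n : ℕ} {f g : Fin n → ℝ}
    (h : Delta n 1 *ᵥ f = Delta n 1 *ᵥ g) (hsum : ∑ i, f i = ∑ i, g i) : f = g := by
  rcases Nat.eq_zero_or_pos n with rfl | hn
  · exact Subsingleton.elim _ _
  have hconst : ∀ (i : ℕ) (hi : i < n), f ⟨i, hi⟩ - g ⟨i, hi⟩ = f ⟨0, hn⟩ - g ⟨0, hn⟩ := by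
    intro i
    induction i with
    | zero => intro _; rfl
    | succ i ih =>
      intro hi
      have hstep := congrFun h ⟨i, by omega⟩
      rw [Delta_one_mulVec, Delta_one_mulVec] at hstep
      have := ih (by omega)
      dsimp only at hstep
      linarith
  have hzero : ∑ i, (f i - g i) = 0 := by rw [sum_sub_distrib, hsum, sub_self]
  rw [sum_congr rfl (fun (i : Fin n) _ => hconst i i.2)] at hzero
  simp only [sum_const, card_univ, Fintype.card_fin, nsmul_eq_mul, mul_eq_zero,
    Nat.cast_eq_zero, hn.ne', false_or] at hzero
  funext i
  have := hconst i i.2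
  rw [hzero] at this
  exact sub_eq_zero.1 this

theorem sum_DeltaPinv_one (n : ℕ) (r : Fin (n - 1)) : ∑ i, DeltaPinv n 1 i r = 0 := by
  have hone : Delta n 1 *ᵥ 1 = 0 := by
    funext s
    simp [Delta_one_mulVec]
  have : (1 : Fin n → ℝ) ᵥ* DeltaPinv n 1 = 0 := by
    rw [DeltaPinv, ← vecMul_vecMul, vecMul_transpose, hone, zero_vecMul]
  simpa [vecMul, dotProduct] using congrFun this r

/-- Subsection 3.1.2: the entries of `Δ(1)⁺` are
`ψ_{i,j}^𝒟 = (j-1)/n` if `j ≤ i` and `ψ_{i,j}^𝒟 = -(n-j+1)/n` if `j > i`, and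
consequently `‖ψ_j^𝒟‖₂² = (j-1)(n-j+1)/n` for all `j ∈ {2,…,n}`.
Here row `i : Fin n` corresponds to the 1-based index `i + 1 ∈ {1,…,n}` and the column
of index `r : Fin (n-1)` corresponds to `j = r + 2 ∈ {2,…,n}`. -/
theorem stmt_16
    (n : ℕ) (hn : 2 ≤ n)
    (hinv : IsUnit (Delta n 1 * (Delta n 1)ᵀ).det) :
    (∀ (i : Fin n) (r : Fin (n - 1)),
      DeltaPinv n 1 i r =
        if (r : ℕ) + 2 ≤ (i : ℕ) + 1 then (((r : ℕ) : ℝ) + 2 - 1) / n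
        else -(((n : ℝ) - (((r : ℕ) : ℝ) + 2) + 1) / n)) ∧
    ∀ r : Fin (n - 1),
      (∑ i, (DeltaPinv n 1 i r) ^ 2) =
        ((((r : ℕ) : ℝ) + 2 - 1) * ((n : ℝ) - (((r : ℕ) : ℝ) + 2) + 1)) / n := by
  have hn0 : (n : ℝ) ≠ 0 := by positivity
  have hent : ∀ (i : Fin n) (r : Fin (n - 1)),
      DeltaPinv n 1 i r =
        if (r : ℕ) + 2 ≤ (i : ℕ) + 1 then (((r : ℕ) : ℝ) + 2 - 1) / n
        else -(((n : ℝ) - (((r : ℕ) : ℝ) + 2) + 1) / n) := by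
    intro i r
    refine congrFun (eq_of_Delta_one_mulVec_eq (f := fun i => DeltaPinv n 1 i r)
      (g := fun i => if (r : ℕ) + 2 ≤ (i : ℕ) + 1 then (((r : ℕ) : ℝ) + 2 - 1) / n
        else -(((n : ℝ) - (((r : ℕ) : ℝ) + 2) + 1) / n)) ?_ ?_) i
    · funext s
      have hright : Delta n 1 * DeltaPinv n 1 = 1 := by
        rw [DeltaPinv, ← Matrix.mul_assoc, mul_nonsing_inv _ hinv]
      have hcol : (Delta n 1 *ᵥ fun i => DeltaPinv n 1 i r) s =
          (1 : Matrix (Fin (n - 1)) (Fin (n - 1)) ℝ) s r := by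
        rw [← hright]
        rfl
      rw [hcol, Delta_one_mulVec, one_apply]
      simp only [Fin.ext_iff]
      rcases lt_trichotomy (s : ℕ) r with h | h | h
      · rw [if_neg (by omega), if_neg (by omega), if_neg (by omega), sub_self]
      · rw [if_pos h, if_pos (by omega), if_neg (by omega)]
        field_simp
        ring
      · rw [if_neg (by omega), if_pos (by omega), if_pos (by omega), sub_self]
    · rw [sum_DeltaPinv_one]
      simp only [show ∀ i : ℕ, (r : ℕ) + 2 ≤ i + 1 ↔ (r : ℕ) + 1 ≤ i by omega]
      rw [sum_fin_step n (r + 1) (by omega)]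
      push_cast
      ring
  refine ⟨hent, fun r => ?_⟩
  simp only [hent, ite_pow, show ∀ i : ℕ, (r : ℕ) + 2 ≤ i + 1 ↔ (r : ℕ) + 1 ≤ i by omega]
  rw [sum_fin_step n (r + 1) (by omega)]
  push_cast
  field_simp
  ring
end
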